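/- Let ε > 0 be a constant. There exist constants c₀, c₁, c₂ > 0 and n₀, all depending only on ε, such that the following holds for every n ≥ n₀: for every real λ with 1 < λ < n and every matrix A_n = (a_{ij}) ∈ n·Ω_n with ε ≤ a_{ij} ≤ λ for all 1 ≤ i, j ≤ n, if X_n = (x_{ij}) is the random n×n matrix with x_{ij} = √(a_{ij})·g_{ij}, where (g_{ij})_{1≤i,j≤n} are independent standard Gaussian random variables (i.e. the underlying probability measure is the product over (i,j) of the standard Gaussian measure N(0,1) on ℝ), then ℙ( |log(det(X_n)²) − log(n!)| ≥ c₀·√(λn)·(log n)^{c₁} ) ≤ exp(−c₂·(log n)⁴). -/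

import Mathlib

open MeasureTheory ProbabilityTheory

noncomputable section

namespace GaussianDet

section Resolvent

open Matrix

variable {ι : Type*} [Fintype ι] [DecidableEq ι]

/-- The regularized inverse Gram matrix `(η + X Xᵀ)⁻¹`. -/
def gramInv (X : Matrix ι ι ℝ) (η : ℝ) : Matrix ι ι ℝ := (η • (1 : Matrix ι ι ℝ) + X * Xᵀ)⁻¹

theorem posDef_smul_one_add_gram (X : Matrix ι ι ℝ) {η : ℝ} (hη : 0 < η) :
    (η • (1 : Matrix ι ι ℝ) + X * Xᵀ).PosDef := by
  have h1 : (η • (1 : Matrix ι ι ℝ)).PosDef := Matrix.PosDef.one.smul hη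
  have h2 : (X * Xᵀ).PosSemidef := by
    simpa [conjTranspose_eq_transpose_of_trivial] using posSemidef_self_mul_conjTranspose X
  exact h1.add_posSemidef h2

theorem det_smul_one_add_gram_pos (X : Matrix ι ι ℝ) {η : ℝ} (hη : 0 < η) :
    0 < (η • (1 : Matrix ι ι ℝ) + X * Xᵀ).det := (posDef_smul_one_add_gram X hη).det_pos

theorem mul_gramInv (X : Matrix ι ι ℝ) {η : ℝ} (hη : 0 < η) :
    (η • (1 : Matrix ι ι ℝ) + X * Xᵀ) * gramInv X η = 1 :=
  mul_nonsing_inv _ (det_smul_one_add_gram_pos X hη).ne'.isUnit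

theorem gramInv_transpose_eq (X : Matrix ι ι ℝ) (η : ℝ) : (gramInv X η)ᵀ = gramInv X η := by
  simp [gramInv, transpose_nonsing_inv, transpose_mul]

theorem smul_gramInv_add (X : Matrix ι ι ℝ) {η : ℝ} (hη : 0 < η) :
    η • gramInv X η + X * Xᵀ * gramInv X η = 1 := by
  have := mul_gramInv X hη
  rwa [add_mul, smul_mul_assoc, one_mul] at this

theorem mulVec_gramInv_add (X : Matrix ι ι ℝ) {η : ℝ} (hη : 0 < η) (v : ι → ℝ) :
    η • (gramInv X η *ᵥ v) + X *ᵥ (Xᵀ *ᵥ (gramInv X η *ᵥ v)) = v := by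
  have := congrArg (fun M => M *ᵥ v) (smul_gramInv_add X hη)
  simpa [add_mulVec, smul_mulVec, mulVec_mulVec, mul_assoc] using this

omit [DecidableEq ι] in
theorem dotProduct_self_nonneg_real (v : ι → ℝ) : 0 ≤ v ⬝ᵥ v :=
  Finset.sum_nonneg fun i _ => mul_self_nonneg (v i)

omit [DecidableEq ι] in
theorem dotProduct_mulVec_gram (X : Matrix ι ι ℝ) (v w : ι → ℝ) :
    v ⬝ᵥ (X *ᵥ (Xᵀ *ᵥ w)) = (Xᵀ *ᵥ v) ⬝ᵥ (Xᵀ *ᵥ w) := by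
  rw [dotProduct_mulVec, ← mulVec_transpose]

theorem gramInv_mulVec_sq_le (X : Matrix ι ι ℝ) {η : ℝ} (hη : 0 < η) (v : ι → ℝ) :
    η * ((gramInv X η *ᵥ v) ⬝ᵥ (gramInv X η *ᵥ v)) ≤ v ⬝ᵥ (gramInv X η *ᵥ v) := by
  set w := gramInv X η *ᵥ v with hw
  have h := congrArg (fun u => w ⬝ᵥ u) (mulVec_gramInv_add X hη v)
  simp only [dotProduct_add, dotProduct_smul, dotProduct_mulVec_gram, smul_eq_mul, ← hw] at h
  have h0 : 0 ≤ (Xᵀ *ᵥ w) ⬝ᵥ (Xᵀ *ᵥ w) := dotProduct_self_nonneg_real _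
  rw [dotProduct_comm v w]
  linarith

theorem dotProduct_gramInv_nonneg (X : Matrix ι ι ℝ) {η : ℝ} (hη : 0 < η) (v : ι → ℝ) :
    0 ≤ v ⬝ᵥ (gramInv X η *ᵥ v) :=
  le_trans (mul_nonneg hη.le (dotProduct_self_nonneg_real _)) (gramInv_mulVec_sq_le X hη v)

theorem dotProduct_gramInv_le (X : Matrix ι ι ℝ) {η : ℝ} (hη : 0 < η) (v : ι → ℝ) :
    η * (v ⬝ᵥ (gramInv X η *ᵥ v)) ≤ v ⬝ᵥ v := by
  set w := gramInv X η *ᵥ v with hw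
  have h := mulVec_gramInv_add X hη v
  have h1 := congrArg (fun u => u ⬝ᵥ v) h
  have h2 := congrArg (fun u => (X *ᵥ (Xᵀ *ᵥ w)) ⬝ᵥ u) h
  simp only [add_dotProduct, smul_dotProduct, dotProduct_add, dotProduct_smul, smul_eq_mul,
    ← hw] at h1 h2
  have h3 : 0 ≤ (X *ᵥ (Xᵀ *ᵥ w)) ⬝ᵥ w := by
    rw [dotProduct_comm, dotProduct_mulVec_gram]; exact dotProduct_self_nonneg_real _
  have h4 : 0 ≤ (X *ᵥ (Xᵀ *ᵥ w)) ⬝ᵥ (X *ᵥ (Xᵀ *ᵥ w)) := dotProduct_self_nonneg_real _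
  rw [dotProduct_comm v w]
  nlinarith [mul_nonneg hη.le h3]

theorem gramInv_diag_eq (X : Matrix ι ι ℝ) (η : ℝ) (i : ι) :
    (Pi.single i 1 : ι → ℝ) ⬝ᵥ (gramInv X η *ᵥ Pi.single i 1) = gramInv X η i i := by
  simp

theorem gramInv_diag_nonneg (X : Matrix ι ι ℝ) {η : ℝ} (hη : 0 < η) (i : ι) :
    0 ≤ gramInv X η i i := by
  rw [← gramInv_diag_eq]; exact dotProduct_gramInv_nonneg X hη _

theorem gramInv_diag_le (X : Matrix ι ι ℝ) {η : ℝ} (hη : 0 < η) (i : ι) :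
    gramInv X η i i ≤ 1 / η := by
  have := dotProduct_gramInv_le X hη (Pi.single i 1)
  rw [gramInv_diag_eq] at this
  rw [le_div_iff₀ hη]
  simp at this
  linarith

theorem smul_gramInv_transpose (X : Matrix ι ι ℝ) {η : ℝ} (hη : 0 < η) :
    η • gramInv Xᵀ η = 1 - Xᵀ * gramInv X η * X := by
  have h : gramInv Xᵀ η = η⁻¹ • (1 - Xᵀ * gramInv X η * X) := by
    refine inv_eq_right_inv ?_
    have h1 : Xᵀ * (η • gramInv X η + X * Xᵀ * gramInv X η) * X = Xᵀ * X := by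
      rw [smul_gramInv_add X hη, mul_one]
    rw [transpose_transpose, mul_smul_comm]
    have h2 : (η • (1 : Matrix ι ι ℝ) + Xᵀ * X) * (1 - Xᵀ * gramInv X η * X)
        = η • 1 + Xᵀ * X - Xᵀ * (η • gramInv X η + X * Xᵀ * gramInv X η) * X := by
      simp only [mul_add, add_mul, mul_sub, mul_one, smul_mul_assoc, one_mul, mul_smul_comm,
        Matrix.mul_assoc]
    rw [h2, h1, add_sub_cancel_right, smul_smul, inv_mul_cancel₀ hη.ne', one_smul]
  rw [h, smul_smul, mul_inv_cancel₀ hη.ne', one_smul]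

theorem transpose_mul_self_eq_updateRow (X : Matrix ι ι ℝ) (i : ι) :
    Xᵀ * X = (X.updateRow i 0)ᵀ * (X.updateRow i 0) + vecMulVec (X i) (X i) := by
  ext a b
  simp only [mul_apply, transpose_apply, Matrix.add_apply, vecMulVec_apply]
  rw [← Finset.add_sum_erase _ _ (Finset.mem_univ i),
    ← Finset.add_sum_erase (f := fun x => X.updateRow i 0 x a * X.updateRow i 0 x b) _
      (Finset.mem_univ i)]
  rw [Finset.sum_congr rfl (g := fun x => X.updateRow i 0 x a * X.updateRow i 0 x b)]
  · simp [add_comm]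
  · intro x hx
    rw [updateRow_ne (Finset.ne_of_mem_erase hx)]

/-- The quadratic form of row `i` in the column resolvent of the matrix with row `i` erased. -/
def rowForm (X : Matrix ι ι ℝ) (η : ℝ) (i : ι) : ℝ :=
  X i ⬝ᵥ (gramInv (X.updateRow i 0)ᵀ η *ᵥ X i)

theorem rowForm_nonneg (X : Matrix ι ι ℝ) {η : ℝ} (hη : 0 < η) (i : ι) : 0 ≤ rowForm X η i :=
  dotProduct_gramInv_nonneg _ hη _

theorem gramInv_transpose_updateRow (X : Matrix ι ι ℝ) {η : ℝ} (hη : 0 < η) (i : ι) :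
    gramInv Xᵀ η = gramInv (X.updateRow i 0)ᵀ η - (1 + rowForm X η i)⁻¹ •
      vecMulVec (gramInv (X.updateRow i 0)ᵀ η *ᵥ X i) (gramInv (X.updateRow i 0)ᵀ η *ᵥ X i) := by
  have hq : (1 + rowForm X η i) ≠ 0 := by linarith [rowForm_nonneg X hη i]
  have hY := mul_gramInv (X.updateRow i 0)ᵀ hη
  have hsym := gramInv_transpose_eq (X.updateRow i 0)ᵀ η
  have hqd : rowForm X η i = X i ⬝ᵥ (gramInv (X.updateRow i 0)ᵀ η *ᵥ X i) := rfl
  set K := gramInv (X.updateRow i 0)ᵀ η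
  set q := rowForm X η i
  refine inv_eq_right_inv ?_
  rw [transpose_transpose, transpose_mul_self_eq_updateRow X i, ← add_assoc]
  rw [transpose_transpose] at hY
  set S := η • (1 : Matrix ι ι ℝ) + (X.updateRow i 0)ᵀ * (X.updateRow i 0)
  have e1 : S * vecMulVec (K *ᵥ X i) (K *ᵥ X i) = vecMulVec (X i) (K *ᵥ X i) := by
    rw [mul_vecMulVec, mulVec_mulVec, hY, one_mulVec]
  have e2 : vecMulVec (X i) (X i) * K = vecMulVec (X i) (K *ᵥ X i) := by
    rw [vecMulVec_mul, ← mulVec_transpose, hsym]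
  have e3 : vecMulVec (X i) (X i) * vecMulVec (K *ᵥ X i) (K *ᵥ X i)
      = q • vecMulVec (X i) (K *ᵥ X i) := by
    rw [vecMulVec_mul_vecMulVec, hqd, vecMulVec_smul]
  rw [add_mul, mul_sub, mul_sub, hY, mul_smul_comm, mul_smul_comm, e1, e2, e3]
  set V := vecMulVec (X i) (K *ᵥ X i)
  have : (1 + q)⁻¹ • V + (1 + q)⁻¹ • q • V = V := by
    rw [smul_smul, ← add_smul, ← mul_one_add, inv_mul_cancel₀ hq, one_smul]
  calc 1 - (1 + q)⁻¹ • V + (V - (1 + q)⁻¹ • q • V)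
      = 1 + (V - ((1 + q)⁻¹ • V + (1 + q)⁻¹ • q • V)) := by abel
    _ = 1 := by rw [this]; simp

theorem mul_gramInv_diag (X : Matrix ι ι ℝ) {η : ℝ} (hη : 0 < η) (i : ι) :
    η * gramInv X η i i = 1 / (1 + rowForm X η i) := by
  have hq : (1 + rowForm X η i) ≠ 0 := by linarith [rowForm_nonneg X hη i]
  have h := smul_gramInv_transpose Xᵀ hη
  rw [transpose_transpose] at h
  have h1 : η * gramInv X η i i = 1 - X i ⬝ᵥ (gramInv Xᵀ η *ᵥ X i) := by
    have h2 := congrFun (congrFun h i) i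
    simp only [Matrix.smul_apply, smul_eq_mul, Matrix.sub_apply, one_apply_eq] at h2
    rw [h2, mul_assoc, mul_apply]
    simp only [dotProduct, mulVec, mul_apply, transpose_apply]
  have h3 : X i ⬝ᵥ (gramInv Xᵀ η *ᵥ X i)
      = rowForm X η i - (1 + rowForm X η i)⁻¹ * rowForm X η i * rowForm X η i := by
    rw [gramInv_transpose_updateRow X hη i, sub_mulVec, smul_mulVec, dotProduct_sub,
      dotProduct_smul, vecMulVec_mulVec, dotProduct_smul]
    simp only [smul_eq_mul, MulOpposite.smul_eq_mul_unop, MulOpposite.unop_op]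
    rw [dotProduct_comm (gramInv (X.updateRow i 0)ᵀ η *ᵥ X i) (X i)]
    simp only [rowForm]
    ring
  rw [h1, h3]
  field_simp
  ring

theorem gramInv_transpose_diag_le_updateRow (X : Matrix ι ι ℝ) {η : ℝ} (hη : 0 < η) (i l : ι) :
    gramInv Xᵀ η l l ≤ gramInv (X.updateRow i 0)ᵀ η l l := by
  rw [gramInv_transpose_updateRow X hη i]
  simp only [Matrix.sub_apply, Matrix.smul_apply, vecMulVec_apply, smul_eq_mul]
  have : 0 ≤ (1 + rowForm X η i)⁻¹ := by
    have := rowForm_nonneg X hη i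
    positivity
  nlinarith [mul_nonneg this (mul_self_nonneg ((gramInv (X.updateRow i 0)ᵀ η *ᵥ X i) l))]

theorem sum_mul_gramInv_updateRow_le (X : Matrix ι ι ℝ) {η lam : ℝ} (hη : 0 < η) (hlam : 0 ≤ lam)
    (i : ι) (a : ι → ℝ) (ha : ∀ l, a l ≤ lam) :
    ∑ l, a l * gramInv (X.updateRow i 0)ᵀ η l l ≤ ∑ l, a l * gramInv Xᵀ η l l + lam / η := by
  have hq := rowForm_nonneg X hη i
  have hp : 0 < 1 + rowForm X η i := by linarith
  set w := gramInv (X.updateRow i 0)ᵀ η *ᵥ X i with hw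
  have h1 : ∀ l, gramInv (X.updateRow i 0)ᵀ η l l
      = gramInv Xᵀ η l l + (1 + rowForm X η i)⁻¹ * (w l * w l) := by
    intro l
    rw [gramInv_transpose_updateRow X hη i]
    simp [vecMulVec_apply, ← hw]
  have h2 : η * (w ⬝ᵥ w) ≤ rowForm X η i := gramInv_mulVec_sq_le _ hη _
  simp only [h1, mul_add, Finset.sum_add_distrib]
  gcongr
  calc ∑ l, a l * ((1 + rowForm X η i)⁻¹ * (w l * w l))
      ≤ ∑ l, lam * ((1 + rowForm X η i)⁻¹ * (w l * w l)) := by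
        gcongr with l
        · exact mul_nonneg (by positivity) (mul_self_nonneg _)
        · exact ha l
    _ = lam * ((1 + rowForm X η i)⁻¹ * (w ⬝ᵥ w)) := by
        simp only [dotProduct, Finset.mul_sum]
    _ ≤ lam / η := by
        rw [div_eq_mul_inv]
        gcongr
        rw [inv_mul_le_iff₀ hp, ← div_eq_mul_inv, le_div_iff₀ hη]
        linarith

theorem continuous_gramInv {η : ℝ} (hη : 0 < η) :
    Continuous fun X : Matrix ι ι ℝ => gramInv X η := by
  have h : (fun X : Matrix ι ι ℝ => gramInv X η) = fun X =>
      ((η • (1 : Matrix ι ι ℝ) + X * Xᵀ).det)⁻¹ • (η • (1 : Matrix ι ι ℝ) + X * Xᵀ).adjugate := by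
    funext X
    rw [gramInv, inv_def, Ring.inverse_eq_inv']
  rw [h]
  have hc : Continuous fun X : Matrix ι ι ℝ => η • (1 : Matrix ι ι ℝ) + X * Xᵀ := by fun_prop
  exact (hc.matrix_det.inv₀ fun X => (det_smul_one_add_gram_pos X hη).ne').smul hc.matrix_adjugate

theorem det_and_trace_eigenvalues (X : Matrix ι ι ℝ) :
    ∃ ev : ι → ℝ, (∀ i, 0 ≤ ev i) ∧ (X * Xᵀ).trace = ∑ i, ev i ∧ ∀ η : ℝ,
      (η • (1 : Matrix ι ι ℝ) + X * Xᵀ).det = ∏ i, (η + ev i) ∧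
      ((∀ i, η + ev i ≠ 0) → (gramInv X η).trace = ∑ i, 1 / (η + ev i)) := by
  have hP : (X * Xᵀ).PosSemidef := by
    simpa [conjTranspose_eq_transpose_of_trivial] using posSemidef_self_mul_conjTranspose X
  have hH := hP.isHermitian
  refine ⟨hH.eigenvalues, hP.eigenvalues_nonneg, by simpa using hH.trace_eq_sum_eigenvalues,
    fun η => ?_⟩
  set U : Matrix ι ι ℝ := (hH.eigenvectorUnitary : Matrix ι ι ℝ)
  have hU1 : U * star U = 1 := Unitary.mul_star_self_of_mem hH.eigenvectorUnitary.2
  have hU2 : star U * U = 1 := Unitary.star_mul_self_of_mem hH.eigenvectorUnitary.2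
  have hs : η • (1 : Matrix ι ι ℝ) + X * Xᵀ
      = U * diagonal (fun i => η + hH.eigenvalues i) * star U := by
    have h1 := hH.spectral_theorem
    rw [Unitary.conjStarAlgAut_apply] at h1
    have h2 : diagonal (fun i => η + hH.eigenvalues i)
        = η • (1 : Matrix ι ι ℝ) + diagonal (RCLike.ofReal ∘ hH.eigenvalues) := by
      rw [smul_one_eq_diagonal, diagonal_add]
      rfl
    rw [h2, mul_add, add_mul, mul_smul_comm, mul_one, smul_mul_assoc, hU1]
    congr 1
  constructor
  · rw [hs, det_mul_right_comm, hU1, one_mul, det_diagonal]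
  · intro hne
    have : gramInv X η = U * diagonal (fun i => 1 / (η + hH.eigenvalues i)) * star U := by
      refine inv_eq_right_inv ?_
      rw [hs]
      calc U * diagonal (fun i => η + hH.eigenvalues i) * star U *
            (U * diagonal (fun i => 1 / (η + hH.eigenvalues i)) * star U)
          = U * (diagonal (fun i => η + hH.eigenvalues i) * (star U * U) *
            diagonal (fun i => 1 / (η + hH.eigenvalues i))) * star U := by
              simp only [Matrix.mul_assoc]
        _ = 1 := by
              rw [hU2, mul_one, diagonal_mul_diagonal]
              have : (fun i => (η + hH.eigenvalues i) * (1 / (η + hH.eigenvalues i)))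
                = fun _ => 1 := by
                funext i; rw [mul_one_div_cancel (hne i)]
              rw [this, diagonal_one, mul_one, hU1]
    rw [this, trace_mul_comm, ← Matrix.mul_assoc, hU2, one_mul, trace_diagonal]

end Resolvent

section Resampling

theorem integral_eq_of_measurePreserving_prod {α β δ : Type*} [MeasurableSpace α]
    [MeasurableSpace β] [MeasurableSpace δ] {μ : Measure α} {ν : Measure β} {ρ : Measure δ}
    [SFinite μ] [SFinite ν] {φ : α × β → δ} (hφ : MeasurePreserving φ (μ.prod ν) ρ)
    {G : δ → ℝ} (hG : Integrable G ρ) :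
    ∫ z, G z ∂ρ = ∫ x, ∫ y, G (φ (x, y)) ∂ν ∂μ := by
  have h1 := hφ.integrable_comp_of_integrable hG
  have h2 : ∫ z, G z ∂ρ = ∫ p, G (φ p) ∂(μ.prod ν) := by
    rw [← integral_map hφ.measurable.aemeasurable
      (by rw [hφ.map_eq]; exact hG.aestronglyMeasurable), hφ.map_eq]
  rw [h2]
  exact integral_prod _ h1

theorem measurePreserving_update {ι : Type*} [Fintype ι] [DecidableEq ι] {α : Type*}
    [MeasurableSpace α] (μ : Measure α) [IsProbabilityMeasure μ] (i : ι) :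
    MeasurePreserving (fun p : (ι → α) × α => Function.update p.1 i p.2)
      ((Measure.pi fun _ : ι => μ).prod μ) (Measure.pi fun _ : ι => μ) := by
  have hm : Measurable fun p : (ι → α) × α => Function.update p.1 i p.2 := by
    rw [measurable_pi_iff]
    intro j
    by_cases h : j = i
    · subst h; simpa using measurable_snd
    · simp only [Function.update_of_ne h]
      exact (measurable_pi_apply j).comp measurable_fst
  refine ⟨hm, (Measure.pi_eq fun s hs => ?_).symm⟩
  rw [Measure.map_apply hm (MeasurableSet.univ_pi hs)]
  have : (fun p : (ι → α) × α => Function.update p.1 i p.2) ⁻¹' (Set.univ.pi s)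
      = (Set.univ.pi (Function.update s i Set.univ)) ×ˢ s i := by
    ext p
    simp only [Set.mem_preimage, Set.mem_pi, Set.mem_univ, true_imp_iff, Set.mem_prod]
    constructor
    · intro h
      refine ⟨fun j => ?_, by simpa using h i⟩
      by_cases hj : j = i
      · subst hj; simp
      · simpa [Function.update_of_ne hj] using h j
    · rintro ⟨h1, h2⟩ j
      by_cases hj : j = i
      · subst hj; simpa using h2
      · simpa [Function.update_of_ne hj] using h1 j
  rw [this, Measure.prod_prod, Measure.pi_pi, ← Finset.prod_erase_mul _ _ (Finset.mem_univ i),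
    ← Finset.prod_erase_mul _ (fun j => μ (s j)) (Finset.mem_univ i)]
  simp only [Function.update_self, measure_univ, mul_one]
  congr 1
  refine Finset.prod_congr rfl fun j hj => ?_
  rw [Function.update_of_ne (Finset.ne_of_mem_erase hj)]

variable {ι : Type*} [Fintype ι] [DecidableEq ι]

/-- The standard Gaussian measure on `ι → ℝ`. -/
abbrev gVec (ι : Type*) [Fintype ι] : Measure (ι → ℝ) := Measure.pi fun _ : ι => gaussianReal 0 1

/-- The law of a matrix of independent standard Gaussians, as a product over the rows. -/
abbrev gMat (ι : Type*) [Fintype ι] : Measure (ι → ι → ℝ) := Measure.pi fun _ : ι => gVec ι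

omit [DecidableEq ι] in
theorem measurePreserving_uncurry :
    MeasurePreserving (MeasurableEquiv.curry ι ι ℝ).symm (gMat ι) (gVec (ι × ι)) := by
  refine ⟨MeasurableEquiv.measurable _, (Measure.pi_eq fun s hs => ?_).symm⟩
  rw [MeasurableEquiv.map_apply]
  have : (MeasurableEquiv.curry ι ι ℝ).symm ⁻¹' (Set.univ.pi s)
      = Set.univ.pi fun i => Set.univ.pi fun j => s (i, j) := by
    ext g
    simp [Set.mem_pi, MeasurableEquiv.curry, Function.uncurry]
  rw [this, Measure.pi_pi]
  simp only [Measure.pi_pi]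
  rw [Fintype.prod_prod_type]

omit [DecidableEq ι] in
theorem measurePreserving_curry :
    MeasurePreserving (MeasurableEquiv.curry ι ι ℝ) (gVec (ι × ι)) (gMat ι) :=
  (measurePreserving_uncurry (ι := ι)).symm _

omit [DecidableEq ι] in
theorem measurePreserving_swap_gMat :
    MeasurePreserving (fun g : ι → ι → ℝ => fun i j => g j i) (gMat ι) (gMat ι) := by
  have h : MeasurePreserving (fun g : ι × ι → ℝ => fun p : ι × ι => g p.swap)
      (gVec (ι × ι)) (gVec (ι × ι)) := by
    have hm : Measurable (fun g : ι × ι → ℝ => fun p : ι × ι => g p.swap) :=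
      measurable_pi_iff.2 fun p => measurable_pi_apply _
    refine ⟨hm, (Measure.pi_eq fun s hs => ?_).symm⟩
    rw [Measure.map_apply hm (MeasurableSet.univ_pi hs)]
    have : (fun g : ι × ι → ℝ => fun p : ι × ι => g p.swap) ⁻¹' (Set.univ.pi s)
        = Set.univ.pi fun p => s p.swap := by
      ext g
      simp only [Set.mem_preimage, Set.mem_pi, Set.mem_univ, true_imp_iff]
      exact ⟨fun h p => by simpa using h p.swap, fun h p => by simpa using h p.swap⟩
    rw [this, Measure.pi_pi]
    exact (Equiv.prodComm ι ι).prod_comp fun p => gaussianReal 0 1 (s p)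
  exact (measurePreserving_curry.comp h).comp measurePreserving_uncurry

theorem measurePreserving_update_entry (i k : ι) :
    MeasurePreserving
      (fun p : (ι → ι → ℝ) × ℝ => Function.update p.1 i (Function.update (p.1 i) k p.2))
      ((gMat ι).prod (gaussianReal 0 1)) (gMat ι) := by
  have h := (measurePreserving_curry (ι := ι)).comp
    ((measurePreserving_update (gaussianReal 0 1) (i, k)).comp
      ((measurePreserving_uncurry (ι := ι)).prod (MeasurePreserving.id (gaussianReal 0 1))))
  convert h using 1
  funext p a b
  by_cases ha : a = i
  · subst ha
    by_cases hb : b = k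
    · subst hb; simp [MeasurableEquiv.curry, Function.curry]
    · simp [MeasurableEquiv.curry, Function.curry, Function.uncurry, hb]
  · simp [MeasurableEquiv.curry, Function.curry, Function.uncurry, ha]

end Resampling

section Stein

theorem integral_mul_gaussianReal {f f' : ℝ → ℝ} {C : ℝ} (hf : ∀ t, HasDerivAt f (f' t) t)
    (hm : Measurable f') (hC : ∀ t, |f t| ≤ C) (hC' : ∀ t, |f' t| ≤ C) :
    ∫ t, t * f t ∂(gaussianReal 0 1) = ∫ t, f' t ∂(gaussianReal 0 1) := by
  have hfm : Measurable f := (continuous_iff_continuousAt.2 fun t => (hf t).continuousAt).measurable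
  have hd : ∀ t, HasDerivAt (gaussianPDFReal 0 1) (-t * gaussianPDFReal 0 1 t) t := by
    intro t
    have h1 : HasDerivAt (fun x : ℝ => -(x - 0) ^ 2 / (2 * ((1 : NNReal) : ℝ))) (-t) t := by
      have := (((hasDerivAt_id t).sub_const 0).pow 2).neg.div_const (2 * ((1 : NNReal) : ℝ))
      refine this.congr_deriv ?_
      simp
      ring
    refine (h1.exp.const_mul (Real.sqrt (2 * Real.pi * (1 : NNReal)))⁻¹).congr_deriv ?_
    simp only [gaussianPDFReal]
    ring
  have hi : Integrable (gaussianPDFReal 0 1) := integrable_gaussianPDFReal 0 1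
  have hx : Integrable (fun t => -t * gaussianPDFReal 0 1 t) := by
    have h1 : Integrable (fun t : ℝ => t) (gaussianReal 0 1) :=
      (memLp_id_gaussianReal 1).integrable le_rfl
    rw [gaussianReal_of_var_ne_zero 0 one_ne_zero, integrable_withDensity_iff_integrable_smul'
      (measurable_gaussianPDF _ _) (by simp [gaussianPDF])] at h1
    simp only [toReal_gaussianPDF, smul_eq_mul] at h1
    refine h1.neg.congr (ae_of_all _ fun t => ?_)
    simp only [Pi.neg_apply]; ring
  have h1 := integral_mul_deriv_eq_deriv_mul_of_integrable (u := f) (u' := f')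
    (v := gaussianPDFReal 0 1) (v' := fun t => -t * gaussianPDFReal 0 1 t)
    (fun t _ => hf t) (fun t _ => hd t)
    (hx.bdd_mul hfm.aestronglyMeasurable (ae_of_all _ hC))
    (hi.bdd_mul hm.aestronglyMeasurable (ae_of_all _ hC'))
    (hi.bdd_mul hfm.aestronglyMeasurable (ae_of_all _ hC))
  rw [integral_gaussianReal_eq_integral_smul one_ne_zero,
    integral_gaussianReal_eq_integral_smul one_ne_zero]
  simp only [smul_eq_mul]
  calc ∫ t, gaussianPDFReal 0 1 t * (t * f t)
      = - ∫ t, f t * (-t * gaussianPDFReal 0 1 t) := by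
        rw [← integral_neg]; congr 1; funext t; ring
    _ = ∫ t, f' t * gaussianPDFReal 0 1 t := by rw [h1, neg_neg]
    _ = _ := by congr 1; funext t; ring

variable {ι : Type*} [Fintype ι] [DecidableEq ι]

omit [DecidableEq ι] in
theorem integrable_eval_gVec (l : ι) : Integrable (fun h : ι → ℝ => h l) (gVec ι) := by
  have := (memLp_id_gaussianReal (μ := 0) (v := 1) 1).integrable le_rfl
  exact (measurePreserving_eval (fun _ : ι => gaussianReal 0 1) l).integrable_comp_of_integrable
    (g := id) this

theorem integral_mul_gVec (l : ι) {F F' : (ι → ℝ) → ℝ} {C : ℝ}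
    (hF : ∀ h t, HasDerivAt (fun s => F (Function.update h l s)) (F' (Function.update h l t)) t)
    (hm : Measurable F) (hm' : Measurable F') (hC : ∀ h, |F h| ≤ C) (hC' : ∀ h, |F' h| ≤ C) :
    ∫ h, h l * F h ∂(gVec ι) = ∫ h, F' h ∂(gVec ι) := by
  have hup := measurePreserving_update (ι := ι) (gaussianReal 0 1) l
  have hI1 : Integrable (fun h : ι → ℝ => h l * F h) (gVec ι) :=
    (integrable_eval_gVec l).mul_bdd hm.aestronglyMeasurable (ae_of_all _ hC)
  have hI2 : Integrable F' (gVec ι) :=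
    Integrable.of_bound hm'.aestronglyMeasurable C (ae_of_all _ hC')
  rw [integral_eq_of_measurePreserving_prod hup hI1,
    integral_eq_of_measurePreserving_prod hup hI2]
  congr 1
  funext h
  have hmu : Measurable fun t => Function.update h l t := measurable_update h
  simpa using integral_mul_gaussianReal (f := fun t => F (Function.update h l t))
    (f' := fun t => F' (Function.update h l t)) (hF h) (hm'.comp hmu)
    (fun t => hC _) (fun t => hC' _)

end Stein

section QuadraticForm

open Matrix

variable {ι : Type*} [Fintype ι]

/-- The quadratic form `x · B x` evaluated at `x l = s l * h l`. -/
def scaledForm (B : Matrix ι ι ℝ) (s h : ι → ℝ) : ℝ :=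
  (fun l => s l * h l) ⬝ᵥ (B *ᵥ fun l => s l * h l)

theorem continuous_scaledForm (B : Matrix ι ι ℝ) (s : ι → ℝ) : Continuous (scaledForm B s) := by
  unfold scaledForm dotProduct mulVec dotProduct
  fun_prop

theorem hasDerivAt_mulVec_update [DecidableEq ι] (B : Matrix ι ι ℝ) (s h : ι → ℝ) (l j : ι)
    (t : ℝ) :
    HasDerivAt (fun r => (B *ᵥ fun k => s k * Function.update h l r k) j) (B j l * s l) t := by
  have h1 : HasDerivAt (fun r => ∑ k, B j k * (s k * Function.update h l r k))
      (∑ k, B j k * (s k * (Pi.single l 1 : ι → ℝ) k)) t :=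
    HasDerivAt.fun_sum fun k _ =>
      (((hasDerivAt_pi.1 (hasDerivAt_update h l t)) k).const_mul (s k)).const_mul (B j k)
  refine h1.congr_deriv ?_
  simp [Pi.single_apply]

theorem hasDerivAt_scaledForm_update [DecidableEq ι] {B : Matrix ι ι ℝ} (hB : Bᵀ = B)
    (s h : ι → ℝ) (l : ι) (t : ℝ) :
    HasDerivAt (fun r => scaledForm B s (Function.update h l r))
      (2 * (s l * (B *ᵥ fun k => s k * Function.update h l t k) l)) t := by
  have h1 : HasDerivAt (fun r => ∑ k, (s k * Function.update h l r k) *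
        (B *ᵥ fun k => s k * Function.update h l r k) k)
      (∑ k, ((s k * (Pi.single l 1 : ι → ℝ) k) * (B *ᵥ fun k => s k * Function.update h l t k) k
        + (s k * Function.update h l t k) * (B k l * s l))) t :=
    HasDerivAt.fun_sum fun k _ =>
      (((hasDerivAt_pi.1 (hasDerivAt_update h l t)) k).const_mul (s k)).mul
        (hasDerivAt_mulVec_update B s h l k t)
  refine h1.congr_deriv ?_
  rw [Finset.sum_add_distrib]
  have e1 : ∑ k, (s k * (Pi.single l 1 : ι → ℝ) k) *
      (B *ᵥ fun k => s k * Function.update h l t k) k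
      = s l * (B *ᵥ fun k => s k * Function.update h l t k) l := by
    simp [Pi.single_apply]
  have e2 : ∑ k, (s k * Function.update h l t k) * (B k l * s l)
      = s l * (B *ᵥ fun k => s k * Function.update h l t k) l := by
    rw [mulVec, dotProduct, Finset.mul_sum]
    refine Finset.sum_congr rfl fun k _ => ?_
    have : B k l = B l k := congrFun (congrFun hB l) k
    rw [this]; ring
  rw [e1, e2]; ring

theorem sq_integral_le {Ω : Type*} [MeasurableSpace Ω] {μ : Measure Ω} [IsProbabilityMeasure μ]
    {u : Ω → ℝ} (hu : Integrable u μ) (hu2 : Integrable (fun x => u x ^ 2) μ) :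
    (∫ x, u x ∂μ) ^ 2 ≤ ∫ x, u x ^ 2 ∂μ := by
  set m := ∫ x, u x ∂μ
  have h : 0 ≤ ∫ x, (u x - m) ^ 2 ∂μ := integral_nonneg fun x => sq_nonneg _
  have hi : Integrable (fun x => u x ^ 2 - 2 * m * u x) μ := hu2.sub (hu.const_mul _)
  have e : ∫ x, (u x - m) ^ 2 ∂μ = ∫ x, u x ^ 2 ∂μ - m ^ 2 := by
    calc ∫ x, (u x - m) ^ 2 ∂μ = ∫ x, ((u x ^ 2 - 2 * m * u x) + m ^ 2) ∂μ := by
          congr 1; funext x; ring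
      _ = _ := by
          rw [integral_add hi (integrable_const _),
            integral_sub hu2 (hu.const_mul _), integral_const_mul]
          simp
          ring
  linarith

theorem integral_inv_add_scaledForm_le [DecidableEq ι] {B : Matrix ι ι ℝ} (hB : Bᵀ = B)
    (hB2 : ∀ v, (B *ᵥ v) ⬝ᵥ (B *ᵥ v) ≤ v ⬝ᵥ (B *ᵥ v)) {a : ι → ℝ} {lam η : ℝ}
    (ha : ∀ l, 0 ≤ a l) (hal : ∀ l, a l ≤ lam) (hlam : 0 ≤ lam) (hη : 4 * lam < η) :
    ∫ h, 1 / (η + scaledForm B (fun l => Real.sqrt (a l)) h) ∂(gVec ι)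
      ≤ 1 / (η - 4 * lam + ∑ l, a l * B l l) := by
  set s : ι → ℝ := fun l => Real.sqrt (a l) with hs
  have hss : ∀ l, s l * s l = a l := fun l => Real.mul_self_sqrt (ha l)
  have hs0 : ∀ l, 0 ≤ s l := fun l => Real.sqrt_nonneg _
  have hη0 : 0 < η := by linarith
  set y : (ι → ℝ) → ℝ := scaledForm B s with hy
  set z : (ι → ℝ) → ι → ℝ := fun h => B *ᵥ fun l => s l * h l with hz
  have hzz : ∀ h, z h ⬝ᵥ z h ≤ y h := fun h => hB2 _
  have hzl : ∀ h l, z h l * z h l ≤ y h := fun h l =>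
    le_trans (Finset.single_le_sum (f := fun l => z h l * z h l)
      (fun l _ => mul_self_nonneg _) (Finset.mem_univ l)) (hzz h)
  have hy0 : ∀ h, 0 ≤ y h := fun h => (dotProduct_self_nonneg_real _).trans (hzz h)
  have hpos : ∀ h, 0 < η + y h := fun h => by linarith [hy0 h]
  have hBll : ∀ l, 0 ≤ B l l := by
    intro l
    have := (dotProduct_self_nonneg_real _).trans (hB2 (Pi.single l 1))
    simpa using this
  have hyc : Continuous y := continuous_scaledForm B s
  have hzc : ∀ l, Continuous fun h => z h l := by
    intro l
    simp only [hz, mulVec, dotProduct]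
    fun_prop
  set u : (ι → ℝ) → ℝ := fun h => 1 / (η + y h) with hu
  have hu0 : ∀ h, 0 < u h := fun h => one_div_pos.2 (hpos h)
  have huη : ∀ h, u h ≤ 1 / η := fun h =>
    one_div_le_one_div_of_le hη0 (by linarith [hy0 h])
  have huy : ∀ h, u h * y h = 1 - η * u h := by
    intro h
    have := (hpos h).ne'
    simp only [hu]; field_simp; ring
  have huc : Continuous u := by
    simp only [hu]
    exact continuous_const.div (continuous_const.add hyc) fun h => (hpos h).ne'
  set F : ι → (ι → ℝ) → ℝ := fun l h => s l * (z h l * u h ^ 2) with hF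
  set F' : ι → (ι → ℝ) → ℝ := fun l h =>
    a l * B l l * u h ^ 2 - 4 * (a l * (z h l * z h l) * u h ^ 3) with hF'
  have hFc : ∀ l, Continuous (F l) := fun l => by
    have := hzc l
    simp only [hF]; fun_prop
  have hFc' : ∀ l, Continuous (F' l) := fun l => by
    have := hzc l
    simp only [hF']; fun_prop
  have hd : ∀ l h t, HasDerivAt (fun r => F l (Function.update h l r))
      (F' l (Function.update h l t)) t := by
    intro l h t
    have d1 : HasDerivAt (fun r => z (Function.update h l r) l) (B l l * s l) t :=
      hasDerivAt_mulVec_update B s h l l t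
    have d2 : HasDerivAt (fun r => y (Function.update h l r))
        (2 * (s l * z (Function.update h l t) l)) t := hasDerivAt_scaledForm_update hB s h l t
    have d3 : HasDerivAt (fun r => u (Function.update h l r))
        (-(2 * (s l * z (Function.update h l t) l)) * u (Function.update h l t) ^ 2) t := by
      have := (d2.const_add η).fun_inv (hpos _).ne'
      simp only [hu, one_div]
      refine this.congr_deriv ?_
      rw [div_eq_mul_inv, inv_pow]
    refine ((d1.mul (d3.fun_pow 2)).const_mul (s l)).congr_deriv ?_
    simp only [hF', ← hss l]
    push_cast
    ring
  have hu2y : ∀ h, u h ^ 2 * y h ≤ 1 / η := by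
    intro h
    have : u h * y h ≤ 1 := by rw [huy]; nlinarith [hu0 h]
    calc u h ^ 2 * y h = u h * (u h * y h) := by ring
      _ ≤ u h * 1 := by gcongr; exact (hu0 h).le
      _ ≤ 1 / η := by rw [mul_one]; exact huη h
  have hu2 : ∀ h, u h ^ 2 ≤ (1 / η) ^ 2 := fun h => by
    gcongr
    · exact (hu0 h).le
    · exact huη h
  have hbF : ∀ l h, |F l h| ≤ s l * ((1 / η) ^ 2 + 1 / η) := by
    intro l h
    simp only [hF, abs_mul, abs_of_nonneg (hs0 l), abs_of_nonneg (sq_nonneg (u h))]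
    refine mul_le_mul_of_nonneg_left ?_ (hs0 l)
    have h1 : |z h l| ≤ 1 + y h := by
      rw [abs_le]
      constructor <;> nlinarith [hzl h l, sq_nonneg (z h l + 1), sq_nonneg (z h l - 1)]
    calc |z h l| * u h ^ 2 ≤ (1 + y h) * u h ^ 2 := by gcongr
      _ = u h ^ 2 + u h ^ 2 * y h := by ring
      _ ≤ _ := add_le_add (hu2 h) (hu2y h)
  have hbF' : ∀ l h, |F' l h| ≤ a l * B l l * (1 / η) ^ 2 + 4 * (a l * (1 / η) ^ 2) := by
    intro l h
    have h1 : 0 ≤ a l * B l l * u h ^ 2 := mul_nonneg (mul_nonneg (ha l) (hBll l)) (sq_nonneg _)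
    have h2 : 0 ≤ a l * (z h l * z h l) * u h ^ 3 :=
      mul_nonneg (mul_nonneg (ha l) (mul_self_nonneg _)) (pow_nonneg (hu0 h).le 3)
    have h3 : a l * B l l * u h ^ 2 ≤ a l * B l l * (1 / η) ^ 2 :=
      mul_le_mul_of_nonneg_left (hu2 h) (mul_nonneg (ha l) (hBll l))
    have h4 : a l * (z h l * z h l) * u h ^ 3 ≤ a l * (1 / η) ^ 2 := by
      rw [mul_assoc]
      refine mul_le_mul_of_nonneg_left ?_ (ha l)
      calc z h l * z h l * u h ^ 3 ≤ y h * u h ^ 3 :=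
            mul_le_mul_of_nonneg_right (hzl h l) (pow_nonneg (hu0 h).le 3)
        _ = u h * (u h ^ 2 * y h) := by ring
        _ ≤ 1 / η * (1 / η) :=
            mul_le_mul (huη h) (hu2y h) (mul_nonneg (sq_nonneg _) (hy0 h)) (by positivity)
        _ = (1 / η) ^ 2 := by ring
    simp only [hF']
    rw [abs_le]
    constructor <;> nlinarith
  have hst : ∀ l, ∫ h, h l * F l h ∂(gVec ι) = ∫ h, F' l h ∂(gVec ι) := fun l =>
    integral_mul_gVec l (C := s l * ((1 / η) ^ 2 + 1 / η)
        + (a l * B l l * (1 / η) ^ 2 + 4 * (a l * (1 / η) ^ 2)))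
      (hd l) (hFc l).measurable (hFc' l).measurable
      (fun h => (hbF l h).trans (le_add_of_nonneg_right ((abs_nonneg _).trans (hbF' l h))))
      (fun h => (hbF' l h).trans (le_add_of_nonneg_left ((abs_nonneg _).trans (hbF l h))))
  have hi1 : ∀ l, Integrable (fun h : ι → ℝ => h l * F l h) (gVec ι) := fun l =>
    (integrable_eval_gVec l).mul_bdd (hFc l).aestronglyMeasurable (ae_of_all _ (hbF l))
  have hi2 : ∀ l, Integrable (F' l) (gVec ι) := fun l =>
    Integrable.of_bound (hFc' l).aestronglyMeasurable _ (ae_of_all _ (hbF' l))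
  have hiu : Integrable u (gVec ι) :=
    Integrable.of_bound huc.aestronglyMeasurable (1 / η) (ae_of_all _ fun h => by
      rw [Real.norm_eq_abs, abs_of_pos (hu0 h)]; exact huη h)
  have hiu2 : Integrable (fun h => u h ^ 2) (gVec ι) :=
    Integrable.of_bound (huc.pow 2).aestronglyMeasurable ((1 / η) ^ 2) (ae_of_all _ fun h => by
      rw [Real.norm_eq_abs, abs_of_nonneg (sq_nonneg _)]; exact hu2 h)
  set τ := ∑ l, a l * B l l with hτ
  have hτ0 : 0 ≤ τ := Finset.sum_nonneg fun l _ => mul_nonneg (ha l) (hBll l)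
  have hmain : ∫ h, (τ - 4 * lam) * u h ^ 2 ∂(gVec ι)
      ≤ ∫ h, (u h - η * u h ^ 2) ∂(gVec ι) := by
    have e1 : ∫ h, (u h - η * u h ^ 2) ∂(gVec ι) = ∑ l, ∫ h, h l * F l h ∂(gVec ι) := by
      rw [← integral_finsetSum _ fun l _ => hi1 l]
      congr 1
      funext h
      have : ∑ l, h l * F l h = y h * u h ^ 2 := by
        simp only [hF, hy, scaledForm, dotProduct, Finset.sum_mul]
        refine Finset.sum_congr rfl fun l _ => ?_
        simp only [hz]; ring
      rw [this]
      linear_combination (-u h) * huy h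
    rw [e1, Finset.sum_congr rfl fun l _ => hst l, ← integral_finsetSum _ fun l _ => hi2 l]
    refine integral_mono (hiu2.const_mul _) (integrable_finsetSum _ fun l _ => hi2 l) fun h => ?_
    simp only [hF', Finset.sum_sub_distrib, ← Finset.sum_mul, ← Finset.mul_sum, ← hτ]
    have h1 : ∑ l, a l * (z h l * z h l) ≤ lam * y h := by
      calc ∑ l, a l * (z h l * z h l) ≤ ∑ l, lam * (z h l * z h l) :=
            Finset.sum_le_sum fun l _ => mul_le_mul_of_nonneg_right (hal l) (mul_self_nonneg _)
        _ = lam * (z h ⬝ᵥ z h) := by rw [← Finset.mul_sum]; rfl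
        _ ≤ _ := by gcongr; exact hzz h
    have h2 : (∑ l, a l * (z h l * z h l)) * u h ^ 3 ≤ lam * u h ^ 2 := by
      calc (∑ l, a l * (z h l * z h l)) * u h ^ 3 ≤ lam * y h * u h ^ 3 :=
            mul_le_mul_of_nonneg_right h1 (pow_nonneg (hu0 h).le 3)
        _ = lam * u h ^ 2 * (u h * y h) := by ring
        _ ≤ lam * u h ^ 2 * 1 := by
            refine mul_le_mul_of_nonneg_left ?_ (by positivity)
            rw [huy]; nlinarith [hu0 h]
        _ = _ := mul_one _
    nlinarith
  rw [integral_const_mul, integral_sub hiu (hiu2.const_mul _), integral_const_mul] at hmain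
  have hsq := sq_integral_le hiu hiu2
  have hm : 0 ≤ ∫ h, u h ∂(gVec ι) := integral_nonneg fun h => (hu0 h).le
  set m := ∫ h, u h ∂(gVec ι)
  have hκ : 0 < η - 4 * lam + τ := by linarith
  have hfin : (η - 4 * lam + τ) * m ^ 2 ≤ m := by nlinarith
  rw [le_div_iff₀ hκ]
  rcases hm.eq_or_lt with h0 | h0
  · rw [← h0]; simp
  · nlinarith

end QuadraticForm

section Moments

open Matrix

variable {ι : Type*} [Fintype ι] [DecidableEq ι]

omit [DecidableEq ι] in
theorem memLp_two_eval_gVec (l : ι) : MemLp (fun h : ι → ℝ => h l) 2 (gVec ι) :=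
  (memLp_id_gaussianReal (μ := 0) (v := 1) 2).comp_measurePreserving
    (measurePreserving_eval (fun _ : ι => gaussianReal 0 1) l)

omit [DecidableEq ι] in
theorem integrable_eval_mul_eval_gVec (l k : ι) :
    Integrable (fun h : ι → ℝ => h l * h k) (gVec ι) :=
  (memLp_two_eval_gVec l).integrable_mul (memLp_two_eval_gVec k)

theorem integral_eval_mul_eval_gVec (l k : ι) :
    ∫ h, h l * h k ∂(gVec ι) = if l = k then 1 else 0 := by
  rw [integral_eq_of_measurePreserving_prod (measurePreserving_update (gaussianReal 0 1) l)
    (integrable_eval_mul_eval_gVec l k)]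
  split_ifs with h
  · subst h
    have h1 : ∫ t, t * t ∂(gaussianReal 0 1) = 1 := by
      have := variance_id_gaussianReal (μ := 0) (v := 1)
      rw [variance_eq_integral aemeasurable_id] at this
      simpa [pow_two] using this
    simp [h1]
  · simp [Function.update_of_ne (Ne.symm h), integral_mul_const, integral_id_gaussianReal]

omit [DecidableEq ι] in
theorem scaledForm_eq_sum (B : Matrix ι ι ℝ) (s h : ι → ℝ) :
    scaledForm B s h = ∑ l, ∑ k, s l * s k * B l k * (h l * h k) := by
  simp only [scaledForm, dotProduct, mulVec, Finset.mul_sum]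
  refine Finset.sum_congr rfl fun l _ => Finset.sum_congr rfl fun k _ => ?_
  ring

theorem integral_scaledForm (B : Matrix ι ι ℝ) (s : ι → ℝ) :
    ∫ h, scaledForm B s h ∂(gVec ι) = ∑ l, s l * s l * B l l := by
  simp only [scaledForm_eq_sum]
  have hi : ∀ l k, Integrable (fun h : ι → ℝ => s l * s k * B l k * (h l * h k)) (gVec ι) :=
    fun l k => (integrable_eval_mul_eval_gVec l k).const_mul _
  rw [integral_finsetSum _ fun l _ => integrable_finsetSum _ fun k _ => hi l k]
  refine Finset.sum_congr rfl fun l _ => ?_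
  rw [integral_finsetSum _ fun k _ => hi l k]
  simp [integral_const_mul, integral_eval_mul_eval_gVec]

end Moments

section Profile

open Matrix

variable {ι : Type*} [Fintype ι]

/-- A variance profile with entries in `[0, lam]` whose row and column sums all equal the size. -/
structure IsProfile (A : Matrix ι ι ℝ) (lam : ℝ) : Prop where
  nonneg : ∀ i j, 0 ≤ A i j
  le : ∀ i j, A i j ≤ lam
  row_sum : ∀ i, ∑ j, A i j = Fintype.card ι
  col_sum : ∀ j, ∑ i, A i j = Fintype.card ι

theorem IsProfile.transpose {A : Matrix ι ι ℝ} {lam : ℝ} (h : IsProfile A lam) :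
    IsProfile Aᵀ lam :=
  ⟨fun i j => h.nonneg j i, fun i j => h.le j i, h.col_sum, h.row_sum⟩

/-- The matrix with entries `√(A i j) * g i j`. -/
def profileMat (A : Matrix ι ι ℝ) (g : ι → ι → ℝ) : Matrix ι ι ℝ :=
  Matrix.of fun i j => Real.sqrt (A i j) * g i j

omit [Fintype ι] in
theorem continuous_profileMat (A : Matrix ι ι ℝ) : Continuous (profileMat A) := by
  unfold profileMat
  refine continuous_matrix fun i j => ?_
  simp only [of_apply]
  fun_prop

theorem integral_profileMat_transpose (A : Matrix ι ι ℝ) {f : Matrix ι ι ℝ → ℝ}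
    (hf : Continuous f) :
    ∫ g, f (profileMat A g)ᵀ ∂(gMat ι) = ∫ g, f (profileMat Aᵀ g) ∂(gMat ι) := by
  have hm := measurePreserving_swap_gMat (ι := ι)
  have h := integral_map (f := fun g => f (profileMat Aᵀ g)) (μ := gMat ι)
    hm.measurable.aemeasurable
    (hf.comp (continuous_profileMat Aᵀ)).measurable.aestronglyMeasurable
  rw [hm.map_eq] at h
  exact h.symm

variable [DecidableEq ι]

omit [Fintype ι] in
theorem profileMat_update_row (A : Matrix ι ι ℝ) (g : ι → ι → ℝ) (i : ι) (h : ι → ℝ) :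
    profileMat A (Function.update g i h) i = fun l => Real.sqrt (A i l) * h l := by
  funext l; simp [profileMat]

omit [Fintype ι] in
theorem profileMat_update_updateRow (A : Matrix ι ι ℝ) (g : ι → ι → ℝ) (i : ι) (h v : ι → ℝ) :
    (profileMat A (Function.update g i h)).updateRow i v = (profileMat A g).updateRow i v := by
  ext a b
  by_cases ha : a = i
  · subst ha; simp
  · simp [updateRow_ne ha, profileMat, Function.update_of_ne ha]

theorem rowForm_profileMat_update (A : Matrix ι ι ℝ) (g : ι → ι → ℝ) (η : ℝ) (i : ι) (h : ι → ℝ) :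
    rowForm (profileMat A (Function.update g i h)) η i
      = scaledForm (gramInv ((profileMat A g).updateRow i 0)ᵀ η)
        (fun l => Real.sqrt (A i l)) h := by
  rw [rowForm, profileMat_update_updateRow, profileMat_update_row, scaledForm]

theorem continuous_rowForm {η : ℝ} (hη : 0 < η) (i : ι) :
    Continuous fun X : Matrix ι ι ℝ => rowForm X η i := by
  unfold rowForm
  have h1 : Continuous fun X : Matrix ι ι ℝ => (X.updateRow i 0)ᵀ := by fun_prop
  have h2 := (continuous_gramInv (ι := ι) hη).comp h1
  have h3 : Continuous fun X : Matrix ι ι ℝ => X i := continuous_apply i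
  exact h3.dotProduct (h2.matrix_mulVec h3)

theorem continuous_gramInv_profileMat (A : Matrix ι ι ℝ) {η : ℝ} (hη : 0 < η) (i j : ι) :
    Continuous fun g => gramInv (profileMat A g) η i j :=
  ((continuous_gramInv hη).comp (continuous_profileMat A)).matrix_elem i j

theorem continuous_gramInv_transpose_profileMat (A : Matrix ι ι ℝ) {η : ℝ} (hη : 0 < η) (i j : ι) :
    Continuous fun g => gramInv (profileMat A g)ᵀ η i j :=
  ((continuous_gramInv hη).comp (continuous_profileMat A).matrix_transpose).matrix_elem i j

theorem integrable_gramInv_diag (A : Matrix ι ι ℝ) {η : ℝ} (hη : 0 < η) (i : ι) :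
    Integrable (fun g => gramInv (profileMat A g) η i i) (gMat ι) :=
  Integrable.of_bound (continuous_gramInv_profileMat A hη i i).measurable.aestronglyMeasurable
    (1 / η) (ae_of_all _ fun g => by
      rw [Real.norm_eq_abs, abs_of_nonneg (gramInv_diag_nonneg _ hη i)]
      exact gramInv_diag_le _ hη i)

theorem integrable_gramInv_transpose_diag (A : Matrix ι ι ℝ) {η : ℝ} (hη : 0 < η) (i : ι) :
    Integrable (fun g => gramInv (profileMat A g)ᵀ η i i) (gMat ι) :=
  Integrable.of_bound
    (continuous_gramInv_transpose_profileMat A hη i i).measurable.aestronglyMeasurable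
    (1 / η) (ae_of_all _ fun g => by
      rw [Real.norm_eq_abs, abs_of_nonneg (gramInv_diag_nonneg _ hη i)]
      exact gramInv_diag_le _ hη i)

omit [DecidableEq ι] in
theorem integrable_sq_entry (i j : ι) :
    Integrable (fun g : ι → ι → ℝ => g i j * g i j) (gMat ι) :=
  (measurePreserving_eval (fun _ : ι => gVec ι) i).integrable_comp_of_integrable
    (integrable_eval_mul_eval_gVec j j)

omit [DecidableEq ι] in
theorem integral_sq_entry (i j : ι) : ∫ g, g i j * g i j ∂(gMat ι) = 1 := by
  classical
  have hm := measurePreserving_eval (fun _ : ι => gVec ι) i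
  have h := integral_eval_mul_eval_gVec j j
  rw [if_pos rfl, ← hm.map_eq, integral_map hm.measurable.aemeasurable (by
    rw [hm.map_eq]; exact (integrable_eval_mul_eval_gVec j j).aestronglyMeasurable)] at h
  exact h

theorem integrable_rowForm (A : Matrix ι ι ℝ) (hA : ∀ i j, 0 ≤ A i j) {η : ℝ} (hη : 0 < η) (i : ι) :
    Integrable (fun g => rowForm (profileMat A g) η i) (gMat ι) := by
  have hi : Integrable (fun g : ι → ι → ℝ => 1 / η * ∑ l, A i l * (g i l * g i l)) (gMat ι) :=
    (integrable_finsetSum _ fun l _ => (integrable_sq_entry i l).const_mul _).const_mul _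
  refine hi.mono' ((continuous_rowForm hη i).comp
    (continuous_profileMat A)).measurable.aestronglyMeasurable (ae_of_all _ fun g => ?_)
  rw [Real.norm_eq_abs, abs_of_nonneg (rowForm_nonneg _ hη i)]
  have h := dotProduct_gramInv_le ((profileMat A g).updateRow i 0)ᵀ hη (profileMat A g i)
  have e : profileMat A g i ⬝ᵥ profileMat A g i = ∑ l, A i l * (g i l * g i l) := by
    refine Finset.sum_congr rfl fun l _ => ?_
    simp only [profileMat, of_apply]
    linear_combination (g i l * g i l) * Real.mul_self_sqrt (hA i l)
  rw [e] at h
  rw [one_div, ← div_eq_inv_mul, le_div_iff₀ hη, mul_comm]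
  exact h

theorem integral_rowForm_le {A : Matrix ι ι ℝ} {lam : ℝ} (hlam : 0 ≤ lam)
    (hA : ∀ i j, 0 ≤ A i j) (hA' : ∀ i j, A i j ≤ lam) {η : ℝ} (hη : 0 < η) (i : ι) :
    ∫ g, rowForm (profileMat A g) η i ∂(gMat ι)
      ≤ ∑ l, A i l * ∫ g, gramInv (profileMat A g)ᵀ η l l ∂(gMat ι) + lam / η := by
  rw [integral_eq_of_measurePreserving_prod (measurePreserving_update (gVec ι) i)
    (integrable_rowForm A hA hη i)]
  simp only [rowForm_profileMat_update, integral_scaledForm, Real.mul_self_sqrt (hA _ _)]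
  have hi := fun l => (integrable_gramInv_transpose_diag A hη l).const_mul (A i l)
  have e : ∑ l, A i l * ∫ g, gramInv (profileMat A g)ᵀ η l l ∂(gMat ι) + lam / η
      = ∫ g, (∑ l, A i l * gramInv (profileMat A g)ᵀ η l l + lam / η) ∂(gMat ι) := by
    rw [integral_add (integrable_finsetSum _ fun l _ => hi l) (integrable_const _),
      integral_finsetSum _ fun l _ => hi l]
    simp [integral_const_mul]
  rw [e]
  refine integral_mono_of_nonneg (ae_of_all _ fun g => Finset.sum_nonneg fun l _ =>
      mul_nonneg (hA i l) (gramInv_diag_nonneg _ hη l))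
    ((integrable_finsetSum _ fun l _ => hi l).add (integrable_const _)) (ae_of_all _ fun g => ?_)
  exact sum_mul_gramInv_updateRow_le _ hη hlam i _ (hA' i)

omit [DecidableEq ι] in
theorem one_div_sum_le {w x : ι → ℝ} (hw : ∀ l, 0 ≤ w l) (hw1 : ∑ l, w l = 1)
    (hx : ∀ l, 0 < x l) : 1 / ∑ l, w l * x l ≤ ∑ l, w l * (1 / x l) := by
  obtain ⟨l₀, -, hl₀⟩ : ∃ l ∈ Finset.univ, 0 < w l := by
    by_contra! h
    have : ∑ l, w l ≤ 0 := Finset.sum_nonpos h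
    linarith
  set c := ∑ l, w l * x l with hc
  have hc0 : 0 < c := Finset.sum_pos' (fun l _ => mul_nonneg (hw l) (hx l).le)
    ⟨l₀, Finset.mem_univ _, mul_pos hl₀ (hx l₀)⟩
  have h1 : ∀ l, w l * (2 / c) - w l * x l * (1 / c ^ 2) ≤ w l * (1 / x l) := by
    intro l
    have h2 : 2 / c - x l * (1 / c ^ 2) ≤ 1 / x l := by
      have h3 : 1 / x l - (2 / c - x l * (1 / c ^ 2)) = (x l - c) ^ 2 / (x l * c ^ 2) := by
        have := (hx l).ne'
        field_simp
        ring
      have h4 : 0 ≤ (x l - c) ^ 2 / (x l * c ^ 2) := by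
        have := hx l
        positivity
      linarith
    nlinarith [mul_le_mul_of_nonneg_left h2 (hw l)]
  calc 1 / c = 1 * (2 / c) - c * (1 / c ^ 2) := by field_simp; norm_num
    _ = ∑ l, (w l * (2 / c) - w l * x l * (1 / c ^ 2)) := by
        rw [Finset.sum_sub_distrib, ← Finset.sum_mul, ← Finset.sum_mul, hw1, ← hc]
    _ ≤ _ := Finset.sum_le_sum fun l _ => h1 l

theorem trace_gramInv_transpose (X : Matrix ι ι ℝ) {η : ℝ} (hη : 0 < η) :
    (gramInv Xᵀ η).trace = (gramInv X η).trace := by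
  have h1 := congrArg trace (smul_gramInv_transpose X hη)
  have h2 := congrArg trace (smul_gramInv_add X hη)
  rw [trace_smul, trace_sub, trace_mul_comm, ← Matrix.mul_assoc] at h1
  rw [trace_add, trace_smul] at h2
  simp only [smul_eq_mul] at h1 h2
  have : η * ((gramInv Xᵀ η).trace - (gramInv X η).trace) = 0 := by linarith
  rcases mul_eq_zero.1 this with h | h
  · exact absurd h hη.ne'
  · linarith

/-- The expected trace of the regularized inverse Gram matrix. -/
def meanTrace (A : Matrix ι ι ℝ) (η : ℝ) : ℝ := ∫ g, (gramInv (profileMat A g) η).trace ∂(gMat ι)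

theorem meanTrace_eq_sum (A : Matrix ι ι ℝ) {η : ℝ} (hη : 0 < η) :
    meanTrace A η = ∑ i, ∫ g, gramInv (profileMat A g) η i i ∂(gMat ι) := by
  rw [meanTrace, ← integral_finsetSum _ fun i _ => integrable_gramInv_diag A hη i]
  rfl

theorem meanTrace_eq_sum_transpose (A : Matrix ι ι ℝ) {η : ℝ} (hη : 0 < η) :
    meanTrace A η = ∑ i, ∫ g, gramInv (profileMat A g)ᵀ η i i ∂(gMat ι) := by
  rw [meanTrace, ← integral_finsetSum _ fun i _ => integrable_gramInv_transpose_diag A hη i]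
  refine integral_congr_ae (ae_of_all _ fun g => ?_)
  exact (trace_gramInv_transpose _ hη).symm

theorem card_le_meanTrace {A : Matrix ι ι ℝ} {lam : ℝ} (hlam : 0 ≤ lam) (hA : IsProfile A lam)
    {η : ℝ} (hη : 0 < η) [Nonempty ι] :
    (Fintype.card ι : ℝ) ≤ (η + lam) * meanTrace A η * (1 + meanTrace A η) := by
  set n : ℝ := ((Fintype.card ι : ℕ) : ℝ) with hn
  have hn0 : 0 < n := by simp only [hn]; exact_mod_cast Fintype.card_pos
  set k : ι → ℝ := fun l => ∫ g, gramInv (profileMat A g)ᵀ η l l ∂(gMat ι) with hk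
  have hk0 : ∀ l, 0 ≤ k l := fun l => integral_nonneg fun g => gramInv_diag_nonneg _ hη l
  set d : ι → ℝ := fun i => η + lam + η * ∑ l, A i l * k l with hd
  have hd0 : ∀ i, 0 < d i := fun i => by
    have : 0 ≤ ∑ l, A i l * k l := Finset.sum_nonneg fun l _ => mul_nonneg (hA.nonneg i l) (hk0 l)
    simp only [hd]; positivity
  have h1 : ∀ i, 1 / d i ≤ ∫ g, gramInv (profileMat A g) η i i ∂(gMat ι) := by
    intro i
    set m := ∫ g, rowForm (profileMat A g) η i ∂(gMat ι) with hm
    have hm0 : 0 ≤ m := integral_nonneg fun g => rowForm_nonneg _ hη i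
    have hmd : η + η * m ≤ d i := by
      have := mul_le_mul_of_nonneg_left (integral_rowForm_le hlam hA.nonneg hA.le hη i) hη.le
      rw [mul_add, mul_div_cancel₀ _ hη.ne'] at this
      simp only [hd, hk]
      linarith
    have hq := integrable_rowForm A hA.nonneg hη i
    set c := η + η * m with hc
    have hc0 : 0 < c := by positivity
    calc 1 / d i ≤ 1 / c := one_div_le_one_div_of_le hc0 hmd
      _ = ∫ g, (1 / c + η * m / c ^ 2 - η / c ^ 2 * rowForm (profileMat A g) η i) ∂(gMat ι) := by
          rw [integral_sub (integrable_const _) (hq.const_mul _), integral_const_mul, ← hm]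
          simp
          ring
      _ ≤ _ := by
          refine integral_mono ((integrable_const _).sub (hq.const_mul _))
            (integrable_gramInv_diag A hη i) fun g => ?_
          have hq0 := rowForm_nonneg (profileMat A g) hη i
          set q := rowForm (profileMat A g) η i
          have e : gramInv (profileMat A g) η i i = 1 / (η + η * q) := by
            have h := mul_gramInv_diag (profileMat A g) hη i
            rw [eq_div_iff (by positivity)] at h ⊢
            linarith
          rw [e]
          have e2 : 1 / (η + η * q) - (1 / c + η * m / c ^ 2 - η / c ^ 2 * q)
              = (η * (q - m)) ^ 2 / ((η + η * q) * c ^ 2) := by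
            have : η + η * q ≠ 0 := by positivity
            have hm' : m = (c - η) / η := by rw [hc]; field_simp; ring
            rw [hm']
            field_simp
            ring
          have e3 : 0 ≤ (η * (q - m)) ^ 2 / ((η + η * q) * c ^ 2) := by positivity
          linarith
  have h2 : ∑ i, 1 / d i ≤ meanTrace A η := by
    rw [meanTrace_eq_sum A hη]
    exact Finset.sum_le_sum fun i _ => h1 i
  have h3 : 1 / ∑ i, 1 / n * d i ≤ ∑ i, 1 / n * (1 / d i) :=
    one_div_sum_le (fun _ => by positivity) (by simp [hn]) hd0
  have h4 : ∑ i, 1 / n * d i = η + lam + η * meanTrace A η := by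
    have e : ∑ i, ∑ l, A i l * k l = n * meanTrace A η := by
      rw [Finset.sum_comm, meanTrace_eq_sum_transpose A hη, Finset.mul_sum]
      refine Finset.sum_congr rfl fun l _ => ?_
      rw [← Finset.sum_mul, hA.col_sum]
    rw [← Finset.mul_sum]
    simp only [hd, Finset.sum_add_distrib, ← Finset.mul_sum, e]
    simp only [Finset.sum_const, Finset.card_univ, nsmul_eq_mul, ← hn]
    field_simp
  rw [h4, ← Finset.mul_sum, one_div_mul_eq_div, le_div_iff₀ hn0] at h3
  have ht : 0 ≤ meanTrace A η := by
    rw [meanTrace_eq_sum A hη]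
    exact Finset.sum_nonneg fun i _ => integral_nonneg fun g => gramInv_diag_nonneg _ hη i
  have h5 := h3.trans h2
  rw [one_div_mul_eq_div, div_le_iff₀ (by positivity)] at h5
  nlinarith [mul_nonneg hlam (mul_nonneg ht ht)]

end Profile

section UpperTrace

open Matrix

variable {ι : Type*} [Fintype ι] [DecidableEq ι]

theorem integral_gramInv_diag_le {A : Matrix ι ι ℝ} {lam : ℝ} (hlam : 0 ≤ lam)
    (hA : IsProfile A lam) {η : ℝ} (hη0 : 0 < η) (hη : 4 * lam < η) (i : ι) :
    ∫ g, gramInv (profileMat A g) η i i ∂(gMat ι)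
      ≤ ∫ g, 1 / (η - 4 * lam + ∑ l, A i l * (η * gramInv (profileMat A g)ᵀ η l l)) ∂(gMat ι) := by
  rw [integral_eq_of_measurePreserving_prod (measurePreserving_update (gVec ι) i)
    (integrable_gramInv_diag A hη0 i)]
  have hS : ∀ g, 0 ≤ ∑ l, A i l * (η * gramInv (profileMat A g)ᵀ η l l) := fun g =>
    Finset.sum_nonneg fun l _ => mul_nonneg (hA.nonneg i l)
      (mul_nonneg hη0.le (gramInv_diag_nonneg _ hη0 l))
  have hc : Continuous fun g => 1 / (η - 4 * lam +
      ∑ l, A i l * (η * gramInv (profileMat A g)ᵀ η l l)) := by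
    refine continuous_const.div (continuous_const.add (continuous_finsetSum _ fun l _ =>
      continuous_const.mul (continuous_const.mul
        (continuous_gramInv_transpose_profileMat A hη0 l l)))) fun g => ?_
    linarith [hS g]
  refine integral_mono_of_nonneg (ae_of_all _ fun g => integral_nonneg fun h =>
    gramInv_diag_nonneg _ hη0 i) (Integrable.of_bound hc.measurable.aestronglyMeasurable
      (1 / (η - 4 * lam)) (ae_of_all _ fun g => ?_)) (ae_of_all _ fun g => ?_)
  · have := hS g
    rw [Real.norm_eq_abs, abs_of_nonneg (one_div_nonneg.2 (by linarith))]
    exact one_div_le_one_div_of_le (by linarith) (by linarith)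
  · set K := gramInv ((profileMat A g).updateRow i 0)ᵀ η with hK
    have h1 : ∀ h, gramInv (profileMat A (Function.update g i h)) η i i
        = 1 / (η + scaledForm (η • K) (fun l => Real.sqrt (A i l)) h) := by
      intro h
      have e := mul_gramInv_diag (profileMat A (Function.update g i h)) hη0 i
      have hq := rowForm_nonneg (profileMat A (Function.update g i h)) hη0 i
      rw [rowForm_profileMat_update, ← hK] at e hq
      have e2 : scaledForm (η • K) (fun l => Real.sqrt (A i l)) h
          = η * scaledForm K (fun l => Real.sqrt (A i l)) h := by
        simp [scaledForm, smul_mulVec]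
      rw [e2]
      rw [eq_div_iff (by positivity)] at e ⊢
      linarith
    have hsymm : (η • K)ᵀ = η • K := by rw [transpose_smul, gramInv_transpose_eq]
    have hB2 : ∀ v, ((η • K) *ᵥ v) ⬝ᵥ ((η • K) *ᵥ v) ≤ v ⬝ᵥ ((η • K) *ᵥ v) := by
      intro v
      have := gramInv_mulVec_sq_le ((profileMat A g).updateRow i 0)ᵀ hη0 v
      rw [← hK] at this
      simp only [smul_mulVec, dotProduct_smul, smul_dotProduct, smul_eq_mul]
      exact mul_le_mul_of_nonneg_left this hη0.le
    simp only [h1]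
    refine (integral_inv_add_scaledForm_le hsymm hB2 (hA.nonneg i) (hA.le i) hlam hη).trans ?_
    refine one_div_le_one_div_of_le (by linarith [hS g]) ?_
    gcongr with l
    · exact hA.nonneg i l
    · simp only [Matrix.smul_apply, smul_eq_mul]
      exact mul_le_mul_of_nonneg_left (gramInv_transpose_diag_le_updateRow _ hη0 i l) hη0.le

theorem integral_gramInv_diag_le_of_forall_le {A : Matrix ι ι ℝ} {lam : ℝ} (hlam : 0 ≤ lam)
    (hA : IsProfile A lam) {η : ℝ} (hη0 : 0 < η) (hη : 4 * lam < η) {T : ℝ}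
    (hT : ∀ i, ∫ g, gramInv (profileMat A g) η i i ∂(gMat ι) ≤ T) [Nonempty ι] (i : ι) :
    ∫ g, gramInv (profileMat A g) η i i ∂(gMat ι)
      ≤ (1 + (Fintype.card ι * T + lam / η)) /
        ((η - 4 * lam) * (1 + (Fintype.card ι * T + lam / η)) + Fintype.card ι) := by
  set n : ℝ := ((Fintype.card ι : ℕ) : ℝ) with hn
  have hn0 : 0 < n := by simp only [hn]; exact_mod_cast Fintype.card_pos
  set η' := η - 4 * lam with hη'
  have hη'0 : 0 < η' := by linarith
  set M := n * T + lam / η with hM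
  have hqi : ∀ l, Integrable (fun g => rowForm (profileMat A g)ᵀ η l) (gMat ι) := fun l => by
    have h1 := integrable_rowForm Aᵀ hA.transpose.nonneg hη0 l
    exact (measurePreserving_swap_gMat (ι := ι)).integrable_comp_of_integrable h1
  have hqm : ∀ l, ∫ g, rowForm (profileMat A g)ᵀ η l ∂(gMat ι) ≤ M := by
    intro l
    rw [integral_profileMat_transpose A (f := fun X => rowForm X η l) (continuous_rowForm hη0 l)]
    refine (integral_rowForm_le hlam hA.transpose.nonneg hA.transpose.le hη0 l).trans ?_
    have h2 : ∀ k, ∫ g, gramInv (profileMat Aᵀ g)ᵀ η k k ∂(gMat ι) ≤ T := by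
      intro k
      have := integral_profileMat_transpose Aᵀ (f := fun X => gramInv X η k k)
        ((continuous_gramInv hη0).matrix_elem k k)
      rw [transpose_transpose] at this
      rw [this]
      exact hT k
    have h3 : ∑ k, Aᵀ l k * ∫ g, gramInv (profileMat Aᵀ g)ᵀ η k k ∂(gMat ι) ≤ ∑ k, Aᵀ l k * T :=
      Finset.sum_le_sum fun k _ => mul_le_mul_of_nonneg_left (h2 k) (hA.transpose.nonneg l k)
    rw [← Finset.sum_mul, hA.transpose.row_sum] at h3
    simp only [hM]
    linarith
  have hM0 : 0 ≤ M := (integral_nonneg fun g => rowForm_nonneg _ hη0 i).trans (hqm i)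
  set D := η' * (1 + M) + n with hD
  have hD0 : 0 < D := by positivity
  have hφ : ∀ q : ℝ, 0 ≤ q → 1 / (η' + n * (1 / (1 + q))) ≤ (1 + M) / D + n / D ^ 2 * (q - M) := by
    intro q hq
    have h1 : 0 < η' * (1 + q) + n := by positivity
    have h0 : 0 < 1 + q := by positivity
    have e : (1 + M) / D + n / D ^ 2 * (q - M) - 1 / (η' + n * (1 / (1 + q)))
        = n * η' * (q - M) ^ 2 / (D ^ 2 * (η' * (1 + q) + n)) := by
      have : η' + n * (1 / (1 + q)) = (η' * (1 + q) + n) / (1 + q) := by field_simp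
      rw [this, one_div_div]
      have hM' : M = (D - n) / η' - 1 := by rw [hD]; field_simp; ring
      rw [hM']
      field_simp
      ring
    have : 0 ≤ n * η' * (q - M) ^ 2 / (D ^ 2 * (η' * (1 + q) + n)) := by positivity
    linarith
  refine (integral_gramInv_diag_le hlam hA hη0 hη i).trans ?_
  have hpt : ∀ g, 1 / (η' + ∑ l, A i l * (η * gramInv (profileMat A g)ᵀ η l l))
      ≤ ∑ l, A i l / n * ((1 + M) / D + n / D ^ 2 * (rowForm (profileMat A g)ᵀ η l - M)) := by
    intro g
    have hw1 : ∑ l, A i l / n = 1 := by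
      rw [← Finset.sum_div, hA.row_sum, ← hn, div_self hn0.ne']
    have hq0 := fun l => rowForm_nonneg (profileMat A g)ᵀ hη0 l
    have h1 : η' + ∑ l, A i l * (η * gramInv (profileMat A g)ᵀ η l l)
        = ∑ l, A i l / n * (η' + n * (1 / (1 + rowForm (profileMat A g)ᵀ η l))) := by
      simp only [mul_add, Finset.sum_add_distrib, ← Finset.sum_mul, hw1, one_mul]
      congr 1
      refine Finset.sum_congr rfl fun l _ => ?_
      rw [mul_gramInv_diag _ hη0]
      field_simp
    rw [h1]
    refine (one_div_sum_le (fun l => div_nonneg (hA.nonneg i l) hn0.le) hw1 fun l => ?_).trans ?_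
    · have := hq0 l
      positivity
    · exact Finset.sum_le_sum fun l _ => mul_le_mul_of_nonneg_left (hφ _ (hq0 l))
        (div_nonneg (hA.nonneg i l) hn0.le)
  have hint : ∀ l, Integrable (fun g => A i l / n * ((1 + M) / D
      + n / D ^ 2 * (rowForm (profileMat A g)ᵀ η l - M))) (gMat ι) := fun l =>
    ((integrable_const _).add (((hqi l).sub (integrable_const _)).const_mul _)).const_mul _
  calc ∫ g, 1 / (η' + ∑ l, A i l * (η * gramInv (profileMat A g)ᵀ η l l)) ∂(gMat ι)
      ≤ ∫ g, ∑ l, A i l / n * ((1 + M) / D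
        + n / D ^ 2 * (rowForm (profileMat A g)ᵀ η l - M)) ∂(gMat ι) := by
        refine integral_mono_of_nonneg (ae_of_all _ fun g => ?_)
          (integrable_finsetSum _ fun l _ => hint l) (ae_of_all _ hpt)
        refine one_div_nonneg.2 (add_nonneg hη'0.le (Finset.sum_nonneg fun l _ =>
          mul_nonneg (hA.nonneg i l) (mul_nonneg hη0.le (gramInv_diag_nonneg _ hη0 l))))
    _ = ∑ l, A i l / n * ((1 + M) / D
        + n / D ^ 2 * (∫ g, rowForm (profileMat A g)ᵀ η l ∂(gMat ι) - M)) := by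
        rw [integral_finsetSum _ fun l _ => hint l]
        refine Finset.sum_congr rfl fun l _ => ?_
        have h1 : Integrable (fun g => n / D ^ 2 * (rowForm (profileMat A g)ᵀ η l - M)) (gMat ι) :=
          ((hqi l).sub (integrable_const _)).const_mul _
        rw [integral_const_mul, integral_add (integrable_const _) h1, integral_const_mul,
          integral_sub (hqi l) (integrable_const _)]
        simp
    _ ≤ ∑ l, A i l / n * ((1 + M) / D) := by
        refine Finset.sum_le_sum fun l _ => mul_le_mul_of_nonneg_left ?_
          (div_nonneg (hA.nonneg i l) hn0.le)
        have : 0 ≤ n / D ^ 2 := by positivity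
        nlinarith [hqm l]
    _ = (1 + M) / D := by
        rw [← Finset.sum_mul, ← Finset.sum_div, hA.row_sum, ← hn, div_self hn0.ne', one_mul]

theorem meanTrace_nonneg (A : Matrix ι ι ℝ) {η : ℝ} (hη : 0 < η) : 0 ≤ meanTrace A η := by
  rw [meanTrace_eq_sum A hη]
  exact Finset.sum_nonneg fun i _ => integral_nonneg fun g => gramInv_diag_nonneg _ hη i

theorem meanTrace_le_card {A : Matrix ι ι ℝ} {lam : ℝ} (hlam : 0 ≤ lam) (hA : IsProfile A lam)
    {η : ℝ} (hη0 : 0 < η) (hη : 5 * lam < η) [Nonempty ι] :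
    (η - 5 * lam) * meanTrace A η * (1 + meanTrace A η) ≤ Fintype.card ι := by
  set n : ℝ := ((Fintype.card ι : ℕ) : ℝ) with hn
  have hn0 : 0 < n := by simp only [hn]; exact_mod_cast Fintype.card_pos
  obtain ⟨i, -, hi⟩ := Finset.exists_max_image Finset.univ
    (fun i => ∫ g, gramInv (profileMat A g) η i i ∂(gMat ι)) Finset.univ_nonempty
  set T := ∫ g, gramInv (profileMat A g) η i i ∂(gMat ι) with hT
  have hT0 : 0 ≤ T := integral_nonneg fun g => gramInv_diag_nonneg _ hη0 i
  have h := integral_gramInv_diag_le_of_forall_le hlam hA hη0 (by linarith)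
    (fun j => hi j (Finset.mem_univ j)) i
  rw [← hT, ← hn] at h
  have hr0 : 0 ≤ lam / η := by positivity
  have hη' : 0 < η - 4 * lam := by linarith
  rw [le_div_iff₀ (by positivity)] at h
  have h1 : (η - 4 * lam) * T * (1 + n * T) ≤ 1 + lam / η := by
    nlinarith [mul_nonneg (mul_nonneg hη'.le hT0) hr0]
  have h2 : (η - 5 * lam) * (1 + lam / η) ≤ η - 4 * lam := by
    have e : η - 4 * lam - (η - 5 * lam) * (1 + lam / η) = 5 * lam * (lam / η) := by
      field_simp; ring
    nlinarith [mul_nonneg hlam hr0]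
  have h3 : (η - 5 * lam) * (T * (1 + n * T)) ≤ 1 := by
    have h4 : (η - 5 * lam) * (1 + lam / η) * (T * (1 + n * T)) ≤ 1 + lam / η := by
      refine le_trans (mul_le_mul_of_nonneg_right h2 (by positivity)) ?_
      linarith
    have : 0 < 1 + lam / η := by positivity
    nlinarith
  have h5 : meanTrace A η ≤ n * T := by
    rw [meanTrace_eq_sum A hη0]
    refine (Finset.sum_le_sum fun j _ => hi j (Finset.mem_univ j)).trans ?_
    simp [hn]
  have h6 := meanTrace_nonneg A hη0
  calc (η - 5 * lam) * meanTrace A η * (1 + meanTrace A η)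
      ≤ (η - 5 * lam) * (n * T) * (1 + n * T) := by
        have : 0 < η - 5 * lam := by linarith
        gcongr
    _ = n * ((η - 5 * lam) * (T * (1 + n * T))) := by ring
    _ ≤ n * 1 := by gcongr
    _ = n := mul_one n

end UpperTrace

section LogDet

open Matrix Filter Topology

variable {ι : Type*} [Fintype ι] [DecidableEq ι]

/-- The logarithm of the determinant of `η + X Xᵀ`. -/
def logDet (X : Matrix ι ι ℝ) (η : ℝ) : ℝ := Real.log (η • (1 : Matrix ι ι ℝ) + X * Xᵀ).det

theorem exists_logDet_eq_sum (X : Matrix ι ι ℝ) :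
    ∃ ev : ι → ℝ, (∀ i, 0 ≤ ev i) ∧ (X * Xᵀ).trace = ∑ i, ev i ∧ ∀ η : ℝ, 0 < η →
      logDet X η = ∑ i, Real.log (η + ev i) ∧
        (gramInv X η).trace = ∑ i, 1 / (η + ev i) := by
  obtain ⟨ev, hev, htr, h⟩ := det_and_trace_eigenvalues X
  refine ⟨ev, hev, htr, fun η hη => ?_⟩
  have hne : ∀ i, η + ev i ≠ 0 := fun i => by linarith [hev i, hη] |> ne_of_gt
  refine ⟨?_, (h η).2 hne⟩
  rw [logDet, (h η).1, Real.log_prod fun i _ => hne i]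

theorem hasDerivAt_logDet (X : Matrix ι ι ℝ) {η : ℝ} (hη : 0 < η) :
    HasDerivAt (logDet X) (gramInv X η).trace η := by
  obtain ⟨ev, hev, -, h⟩ := exists_logDet_eq_sum X
  have h1 : HasDerivAt (fun x : ℝ => ∑ i, Real.log (x + ev i)) (∑ i, 1 / (η + ev i)) η :=
    HasDerivAt.fun_sum fun i _ => ((hasDerivAt_id η).add_const (ev i)).log
      (by simpa using (add_pos_of_pos_of_nonneg hη (hev i)).ne')
  rw [(h η hη).2]
  refine h1.congr_of_eventuallyEq ?_
  filter_upwards [Ioi_mem_nhds hη] with x hx using (h x hx).1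

theorem card_mul_log_le_logDet (X : Matrix ι ι ℝ) {η : ℝ} (hη : 0 < η) :
    Fintype.card ι * Real.log η ≤ logDet X η := by
  obtain ⟨ev, hev, -, h⟩ := exists_logDet_eq_sum X
  rw [(h η hη).1, ← nsmul_eq_mul, ← Finset.card_univ, ← Finset.sum_const]
  exact Finset.sum_le_sum fun i _ => Real.log_le_log hη (by linarith [hev i])

theorem logDet_le (X : Matrix ι ι ℝ) {η : ℝ} (hη : 0 < η) :
    logDet X η ≤ Fintype.card ι * Real.log η + (X * Xᵀ).trace / η := by
  obtain ⟨ev, hev, htr, h⟩ := exists_logDet_eq_sum X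
  rw [(h η hη).1, ← nsmul_eq_mul, ← Finset.card_univ, ← Finset.sum_const, htr, Finset.sum_div,
    ← Finset.sum_add_distrib]
  refine Finset.sum_le_sum fun i _ => ?_
  have h1 : η + ev i = η * (1 + ev i / η) := by field_simp
  have h2 : 0 ≤ ev i / η := div_nonneg (hev i) hη.le
  rw [h1, Real.log_mul hη.ne' (by positivity)]
  linarith [Real.log_le_sub_one_of_pos (show 0 < 1 + ev i / η by positivity)]

theorem trace_gramInv_nonneg (X : Matrix ι ι ℝ) {η : ℝ} (hη : 0 < η) :
    0 ≤ (gramInv X η).trace :=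
  Finset.sum_nonneg fun i _ => gramInv_diag_nonneg X hη i

theorem trace_gramInv_le (X : Matrix ι ι ℝ) {η : ℝ} (hη : 0 < η) :
    (gramInv X η).trace ≤ Fintype.card ι / η := by
  calc (gramInv X η).trace ≤ ∑ _i : ι, 1 / η :=
        Finset.sum_le_sum fun i _ => gramInv_diag_le X hη i
    _ = _ := by rw [Finset.sum_const, Finset.card_univ, nsmul_eq_mul, mul_one_div]

theorem continuous_logDet {η : ℝ} (hη : 0 < η) :
    Continuous fun X : Matrix ι ι ℝ => logDet X η :=
  Continuous.log (by fun_prop) fun X => (det_smul_one_add_gram_pos X hη).ne'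

theorem trace_profileMat_gram {κ : Type*} [Fintype κ] (A : Matrix κ κ ℝ) (hA : ∀ i j, 0 ≤ A i j)
    (g : κ → κ → ℝ) :
    (profileMat A g * (profileMat A g)ᵀ).trace = ∑ i, ∑ j, A i j * (g i j * g i j) := by
  simp only [Matrix.trace, Matrix.diag, Matrix.mul_apply, Matrix.transpose_apply, profileMat,
    Matrix.of_apply]
  refine Finset.sum_congr rfl fun i _ => Finset.sum_congr rfl fun j _ => ?_
  rw [mul_mul_mul_comm, Real.mul_self_sqrt (hA i j)]

theorem integrable_trace_profileMat_gram {κ : Type*} [Fintype κ] (A : Matrix κ κ ℝ)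
    (hA : ∀ i j, 0 ≤ A i j) :
    Integrable (fun g => (profileMat A g * (profileMat A g)ᵀ).trace) (gMat κ) := by
  simp only [trace_profileMat_gram A hA]
  exact integrable_finsetSum _ fun i _ => integrable_finsetSum _ fun j _ =>
    (integrable_sq_entry i j).const_mul _

theorem integral_trace_profileMat_gram {κ : Type*} [Fintype κ]
    {A : Matrix κ κ ℝ} {lam : ℝ} (hA : IsProfile A lam) :
    ∫ g, (profileMat A g * (profileMat A g)ᵀ).trace ∂(gMat κ) = (Fintype.card κ : ℝ) ^ 2 := by
  have h1 : ∀ i j, Integrable (fun g : κ → κ → ℝ => A i j * (g i j * g i j)) (gMat κ) :=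
    fun i j => (integrable_sq_entry i j).const_mul _
  calc _ = ∫ g : κ → κ → ℝ, ∑ i, ∑ j, A i j * (g i j * g i j) ∂(gMat κ) := by
        simp only [trace_profileMat_gram A hA.nonneg]
    _ = ∑ i, ∑ j, ∫ g : κ → κ → ℝ, A i j * (g i j * g i j) ∂(gMat κ) := by
        rw [integral_finsetSum _ fun i _ => integrable_finsetSum _ fun j _ => h1 i j]
        exact Finset.sum_congr rfl fun i _ => integral_finsetSum _ fun j _ => h1 i j
    _ = ∑ i, ∑ j, A i j := by simp only [integral_const_mul, integral_sq_entry, mul_one]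
    _ = _ := by
        simp only [hA.row_sum]
        rw [Finset.sum_const, Finset.card_univ, nsmul_eq_mul, sq]

theorem integrable_logDet_profileMat (A : Matrix ι ι ℝ) (hA : ∀ i j, 0 ≤ A i j) {η : ℝ}
    (hη : 0 < η) : Integrable (fun g => logDet (profileMat A g) η) (gMat ι) := by
  refine Integrable.mono' (((integrable_trace_profileMat_gram A hA).div_const η).add
    (integrable_const |(Fintype.card ι : ℝ) * Real.log η|))
    ((continuous_logDet hη).comp (continuous_profileMat A)).measurable.aestronglyMeasurable
    (ae_of_all _ fun g => ?_)
  have h1 := card_mul_log_le_logDet (profileMat A g) hη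
  have h2 := logDet_le (profileMat A g) hη
  have h3 : 0 ≤ (profileMat A g * (profileMat A g)ᵀ).trace / η := by
    refine div_nonneg ?_ hη.le
    rw [trace_profileMat_gram A hA]
    exact Finset.sum_nonneg fun i _ => Finset.sum_nonneg fun j _ =>
      mul_nonneg (hA i j) (mul_self_nonneg _)
  rw [Real.norm_eq_abs, Pi.add_apply, abs_le]
  constructor
  · linarith [neg_abs_le ((Fintype.card ι : ℝ) * Real.log η)]
  · linarith [le_abs_self ((Fintype.card ι : ℝ) * Real.log η)]

/-- The mean of `logDet` under the Gaussian model with variance profile `A`. -/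
def meanLogDet (A : Matrix ι ι ℝ) (η : ℝ) : ℝ := ∫ g, logDet (profileMat A g) η ∂(gMat ι)

theorem card_mul_log_le_meanLogDet (A : Matrix ι ι ℝ) (hA : ∀ i j, 0 ≤ A i j) {η : ℝ}
    (hη : 0 < η) : Fintype.card ι * Real.log η ≤ meanLogDet A η := by
  calc _ = ∫ _g : ι → ι → ℝ, Fintype.card ι * Real.log η ∂(gMat ι) := by simp
    _ ≤ _ := integral_mono (integrable_const _) (integrable_logDet_profileMat A hA hη)
      fun g => card_mul_log_le_logDet _ hη

theorem meanLogDet_le {A : Matrix ι ι ℝ} {lam : ℝ} (hA : IsProfile A lam) {η : ℝ}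
    (hη : 0 < η) :
    meanLogDet A η ≤ Fintype.card ι * Real.log η + (Fintype.card ι : ℝ) ^ 2 / η := by
  have hi := (integrable_trace_profileMat_gram A hA.nonneg).div_const η
  calc meanLogDet A η ≤ ∫ g, (Fintype.card ι * Real.log η +
        (profileMat A g * (profileMat A g)ᵀ).trace / η) ∂(gMat ι) :=
        integral_mono (integrable_logDet_profileMat A hA.nonneg hη)
          ((integrable_const _).add hi) fun g => logDet_le _ hη
    _ = _ := by
        rw [integral_add (integrable_const _) hi, integral_div,
          integral_trace_profileMat_gram hA]
        simp

theorem hasDerivAt_meanLogDet (A : Matrix ι ι ℝ) (hA : ∀ i j, 0 ≤ A i j) {η : ℝ}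
    (hη : 0 < η) : HasDerivAt (meanLogDet A) (meanTrace A η) η := by
  refine (hasDerivAt_integral_of_dominated_loc_of_deriv_le (μ := gMat ι)
    (F := fun x g => logDet (profileMat A g) x)
    (F' := fun x g => (gramInv (profileMat A g) x).trace)
    (bound := fun _ => Fintype.card ι / (η / 2))
    (Ioi_mem_nhds (show η / 2 < η by linarith))
    ?_ (integrable_logDet_profileMat A hA hη) ?_ (ae_of_all _ fun g x hx => ?_)
    (integrable_const _) (ae_of_all _ fun g x hx => ?_)).2
  · filter_upwards [Ioi_mem_nhds hη] with x hx using
      (integrable_logDet_profileMat A hA hx).aestronglyMeasurable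
  · exact Continuous.aestronglyMeasurable (continuous_finsetSum _ fun i _ =>
      continuous_gramInv_profileMat A hη i i)
  · have hx' : η / 2 < x := hx
    have hx0 : 0 < x := by linarith
    rw [Real.norm_of_nonneg (trace_gramInv_nonneg _ hx0)]
    refine (trace_gramInv_le _ hx0).trans ?_
    gcongr
  · exact hasDerivAt_logDet _ (lt_trans (by linarith) (show η / 2 < x from hx))

end LogDet

section Comparison

open Set

/-- The regularization parameter at which the deterministic equivalent of the trace is `u`. -/
def etaOf (n u : ℝ) : ℝ := n / (u * (1 + u))

/-- The deterministic equivalent of `logDet`, as a function of the equivalent `u` of the trace. -/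
def detEquiv (n u : ℝ) : ℝ := n * (Real.log n + Real.log (1 + u) - Real.log u - u / (1 + u))

variable {n u : ℝ}

theorem etaOf_pos (hn : 0 < n) (hu : 0 < u) : 0 < etaOf n u := by
  unfold etaOf; positivity

theorem log_etaOf (hn : 0 < n) (hu : 0 < u) :
    Real.log (etaOf n u) = Real.log n - Real.log u - Real.log (1 + u) := by
  rw [etaOf, Real.log_div hn.ne' (by positivity), Real.log_mul hu.ne' (by positivity)]
  ring

theorem hasDerivAt_etaOf (hu : 0 < u) :
    HasDerivAt (etaOf n) (-(n * (1 + 2 * u)) / (u * (1 + u)) ^ 2) u := by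
  have h : HasDerivAt (fun u : ℝ => u * (1 + u)) (1 * (1 + u) + u * 1) u :=
    (hasDerivAt_id u).mul ((hasDerivAt_id u).const_add 1)
  refine ((hasDerivAt_const u n).div h (by positivity)).congr_deriv ?_
  congr 1; ring

theorem hasDerivAt_detEquiv (hu : 0 < u) :
    HasDerivAt (detEquiv n) (u * (-(n * (1 + 2 * u)) / (u * (1 + u)) ^ 2)) u := by
  have h1 : HasDerivAt (fun u : ℝ => 1 + u) 1 u := (hasDerivAt_id u).const_add 1
  have hp : (1 + u) ≠ 0 := by positivity
  have h2 : HasDerivAt (detEquiv n) _ u :=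
    ((((h1.log hp).const_add (Real.log n)).sub (Real.hasDerivAt_log hu.ne')).sub
      ((hasDerivAt_id u).div h1 hp)).const_mul n
  refine h2.congr_deriv ?_
  simp only [id]
  field_simp
  ring

theorem le_detEquiv (hn : 0 < n) (hu : 0 < u) : n * Real.log n - n ≤ detEquiv n u := by
  have h1 : Real.log u ≤ Real.log (1 + u) := Real.log_le_log hu (by linarith)
  have h2 : u / (1 + u) ≤ 1 := by rw [div_le_one (by positivity)]; linarith
  unfold detEquiv
  nlinarith

theorem detEquiv_le (hn : 0 < n) (hu : 0 < u) :
    detEquiv n u ≤ n * Real.log n - n + 2 * n / u := by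
  have h1 : Real.log (1 + u) - Real.log u ≤ 1 / u := by
    rw [← Real.log_div (by positivity) hu.ne']
    refine (Real.log_le_sub_one_of_pos (by positivity)).trans_eq ?_
    field_simp; ring
  have h2 : 1 - 1 / u ≤ u / (1 + u) := by
    rw [sub_le_iff_le_add, div_add_div _ _ (by positivity) hu.ne', le_div_iff₀ (by positivity)]
    nlinarith
  have h3 : 2 * n / u = n * (2 * (1 / u)) := by ring
  rw [h3]
  unfold detEquiv
  nlinarith

theorem le_of_mul_one_add_le {s t : ℝ} (ht : 0 ≤ t) (h : s * (1 + s) ≤ t * (1 + t)) : s ≤ t := by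
  by_contra! hlt
  nlinarith

theorem detEquiv_le_of_hasDerivAt (hn : 0 < n) {H T : ℝ → ℝ} {c : ℝ} (hc : 0 ≤ c)
    (hH : ∀ η, 0 < η → HasDerivAt H (T η) η) (hH0 : ∀ η, 0 < η → n * Real.log η ≤ H η)
    (hT : ∀ η, c < η → (η - c) * T η * (1 + T η) ≤ n) (hu : 0 < u) :
    detEquiv n u ≤ H (c + etaOf n u) := by
  have hder : ∀ v, 0 < v → HasDerivAt (fun v => H (c + etaOf n v) - detEquiv n v)
      ((T (c + etaOf n v) - v) * (-(n * (1 + 2 * v)) / (v * (1 + v)) ^ 2)) v := fun v hv => by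
    have h := ((hH (c + etaOf n v) (by linarith [etaOf_pos hn hv])).comp v
      ((hasDerivAt_etaOf (n := n) hv).const_add c)).sub (hasDerivAt_detEquiv (n := n) hv)
    exact h.congr_deriv (by ring)
  have hmono : MonotoneOn (fun v => H (c + etaOf n v) - detEquiv n v) (Ioi 0) := by
    refine monotoneOn_of_deriv_nonneg (convex_Ioi 0)
      (fun v hv => (hder v hv).continuousAt.continuousWithinAt)
      (fun v hv => (hder v (interior_subset hv)).differentiableAt.differentiableWithinAt)
      fun v hv => ?_
    have hv : 0 < v := interior_subset hv
    rw [(hder v hv).deriv]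
    have h1 := hT (c + etaOf n v) (by linarith [etaOf_pos hn hv])
    have h2 : T (c + etaOf n v) ≤ v := by
      refine le_of_mul_one_add_le hv.le ?_
      rw [add_sub_cancel_left, etaOf, mul_assoc, div_mul_eq_mul_div,
        div_le_iff₀ (by positivity)] at h1
      exact le_of_mul_le_mul_left h1 hn
    refine mul_nonneg_of_nonpos_of_nonpos (by linarith) (div_nonpos_of_nonpos_of_nonneg ?_ ?_)
    · nlinarith
    · positivity
  have hlow : ∀ v, 0 < v → -(2 * n * v) ≤ H (c + etaOf n v) - detEquiv n v := fun v hv => by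
    have he := etaOf_pos hn hv
    have h1 := hH0 (c + etaOf n v) (by linarith)
    have h2 : Real.log (etaOf n v) ≤ Real.log (c + etaOf n v) := Real.log_le_log he (by linarith)
    rw [log_etaOf hn hv] at h2
    have h3 : Real.log (1 + v) ≤ v := by
      linarith [Real.log_le_sub_one_of_pos (show 0 < 1 + v by positivity)]
    have h4 : 0 ≤ v / (1 + v) := by positivity
    unfold detEquiv
    nlinarith
  refine le_of_forall_pos_le_add fun δ hδ => ?_
  set v := min u (δ / (2 * n)) with hv
  have hv0 : 0 < v := lt_min hu (by positivity)
  have h1 := hmono (show v ∈ Ioi 0 from hv0) (show u ∈ Ioi 0 from hu) (min_le_left _ _)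
  have h2 := hlow v hv0
  have h3 : v * (2 * n) ≤ δ := (le_div_iff₀ (by positivity)).1 (min_le_right _ _)
  simp only at h1
  linarith

theorem le_detEquiv_of_hasDerivAt (hn : 0 < n) {H T : ℝ → ℝ} {lam : ℝ} (hlam : 0 < lam)
    (hH : ∀ η, 0 < η → HasDerivAt H (T η) η)
    (hH0 : ∀ η, 0 < η → H η ≤ n * Real.log η + n ^ 2 / η) (hT0 : ∀ η, 0 < η → 0 ≤ T η)
    (hT : ∀ η, 0 < η → n ≤ (η + lam) * T η * (1 + T η)) (hu : 0 < u)
    (hun : u * (1 + u) * lam < n) :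
    H (etaOf n u - lam) ≤ detEquiv n u := by
  have hpos : ∀ v, 0 < v → v ≤ u → 0 < etaOf n v - lam := fun v hv hvu => by
    rw [sub_pos, etaOf, lt_div_iff₀ (by positivity)]
    have : v * (1 + v) ≤ u * (1 + u) := by nlinarith
    nlinarith
  have hder : ∀ v, 0 < v → v ≤ u → HasDerivAt (fun v => H (etaOf n v - lam) - detEquiv n v)
      ((T (etaOf n v - lam) - v) * (-(n * (1 + 2 * v)) / (v * (1 + v)) ^ 2)) v :=
      fun v hv hvu => by
    have h := ((hH (etaOf n v - lam) (hpos v hv hvu)).comp v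
      ((hasDerivAt_etaOf (n := n) hv).sub_const lam)).sub (hasDerivAt_detEquiv (n := n) hv)
    exact h.congr_deriv (by ring)
  have hanti : AntitoneOn (fun v => H (etaOf n v - lam) - detEquiv n v) (Ioc 0 u) := by
    refine antitoneOn_of_deriv_nonpos (convex_Ioc 0 u)
      (fun v hv => (hder v hv.1 hv.2).continuousAt.continuousWithinAt)
      (fun v hv => (hder v (interior_subset hv).1
        (interior_subset hv).2).differentiableAt.differentiableWithinAt)
      fun v hv => ?_
    obtain ⟨hv, hvu⟩ : v ∈ Ioc 0 u := interior_subset hv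
    rw [(hder v hv hvu).deriv]
    have h1 := hT (etaOf n v - lam) (hpos v hv hvu)
    have h2 : v ≤ T (etaOf n v - lam) := by
      refine le_of_mul_one_add_le (hT0 _ (hpos v hv hvu)) ?_
      rw [sub_add_cancel, etaOf, mul_assoc, div_mul_eq_mul_div,
        le_div_iff₀ (by positivity)] at h1
      exact le_of_mul_le_mul_left h1 hn
    refine mul_nonpos_of_nonneg_of_nonpos (by linarith) (div_nonpos_of_nonpos_of_nonneg ?_ ?_)
    · nlinarith
    · positivity
  have hup : ∀ v, 0 < v → v ≤ u → v ≤ 1 → v * (4 * lam) ≤ n →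
      H (etaOf n v - lam) - detEquiv n v ≤ 5 * n * v := fun v hv hvu hv1 hvn => by
    have hp := hpos v hv hvu
    have h1 := hH0 (etaOf n v - lam) hp
    have h2 : Real.log (etaOf n v - lam) ≤ Real.log (etaOf n v) :=
      Real.log_le_log hp (by linarith)
    rw [log_etaOf hn hv] at h2
    have h3 : 0 ≤ Real.log (1 + v) := Real.log_nonneg (by linarith)
    have h4 : v / (1 + v) ≤ v := div_le_self hv.le (by linarith)
    have h5 : n ^ 2 / (etaOf n v - lam) ≤ 4 * n * v := by
      have h6 : n / (2 * v) ≤ etaOf n v := by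
        exact div_le_div_of_nonneg_left hn.le (by positivity) (by nlinarith)
      have h7 : lam ≤ n / (4 * v) := by rw [le_div_iff₀ (by positivity)]; linarith
      have h8 : n / (2 * v) = n / (4 * v) + n / (4 * v) := by field_simp; norm_num
      have h9 : 0 < n / (4 * v) := by positivity
      calc n ^ 2 / (etaOf n v - lam) ≤ n ^ 2 / (n / (4 * v)) := by gcongr; linarith
        _ = _ := by field_simp
    unfold detEquiv
    nlinarith
  refine le_of_forall_pos_le_add fun δ hδ => ?_
  set v := min (min u 1) (min (n / (4 * lam)) (δ / (5 * n))) with hv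
  have hv0 : 0 < v := lt_min (lt_min hu one_pos) (lt_min (by positivity) (by positivity))
  have hvu : v ≤ u := (min_le_left _ _).trans (min_le_left _ _)
  have h1 := hanti (show v ∈ Ioc 0 u from ⟨hv0, hvu⟩) (show u ∈ Ioc 0 u from ⟨hu, le_rfl⟩) hvu
  have h2 := hup v hv0 hvu ((min_le_left _ _).trans (min_le_right _ _))
    ((le_div_iff₀ (by positivity)).1 ((min_le_right _ _).trans (min_le_left _ _)))
  have h3 : v * (5 * n) ≤ δ :=
    (le_div_iff₀ (by positivity)).1 ((min_le_right _ _).trans (min_le_right _ _))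
  simp only at h1
  linarith

end Comparison

section MeanLogDet

variable {ι : Type*} [Fintype ι] [DecidableEq ι] [Nonempty ι]

theorem le_meanLogDet {A : Matrix ι ι ℝ} {lam : ℝ} (hlam : 0 ≤ lam) (hA : IsProfile A lam)
    {u : ℝ} (hu : 0 < u) :
    Fintype.card ι * Real.log (Fintype.card ι) - Fintype.card ι
      ≤ meanLogDet A (5 * lam + etaOf (Fintype.card ι) u) := by
  have hn : (0 : ℝ) < Fintype.card ι := by exact_mod_cast Fintype.card_pos
  exact (le_detEquiv hn hu).trans (detEquiv_le_of_hasDerivAt hn (by positivity)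
    (fun η hη => hasDerivAt_meanLogDet A hA.nonneg hη)
    (fun η hη => card_mul_log_le_meanLogDet A hA.nonneg hη)
    (fun η hη => meanTrace_le_card hlam hA (by linarith) hη) hu)

theorem meanLogDet_le_of_lt {A : Matrix ι ι ℝ} {lam : ℝ} (hlam : 0 < lam) (hA : IsProfile A lam)
    {u : ℝ} (hu : 0 < u) (hun : u * (1 + u) * lam < Fintype.card ι) :
    meanLogDet A (etaOf (Fintype.card ι) u - lam)
      ≤ Fintype.card ι * Real.log (Fintype.card ι) - Fintype.card ι
        + 2 * Fintype.card ι / u := by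
  have hn : (0 : ℝ) < Fintype.card ι := by exact_mod_cast Fintype.card_pos
  exact (le_detEquiv_of_hasDerivAt hn hlam
    (fun η hη => hasDerivAt_meanLogDet A hA.nonneg hη)
    (fun η hη => meanLogDet_le hA hη) (fun η hη => meanTrace_nonneg A hη)
    (fun η hη => card_le_meanTrace hlam.le hA hη) hu hun).trans (detEquiv_le hn hu)

/-- At regularization at most `6 lam`, the product of the regularization and the mean trace is at
most `6 √(lam n)`, while the mean of `logDet` is at least `n log n - n`. -/
theorem exists_eta_le_meanLogDet {A : Matrix ι ι ℝ} {lam : ℝ} (hlam : 0 < lam)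
    (hA : IsProfile A lam) : ∃ η : ℝ, 5 * lam < η ∧ η ≤ 6 * lam ∧
      Fintype.card ι * Real.log (Fintype.card ι) - Fintype.card ι ≤ meanLogDet A η ∧
      η * meanTrace A η ≤ 6 * Real.sqrt (lam * Fintype.card ι) := by
  have hn : (0 : ℝ) < Fintype.card ι := by exact_mod_cast Fintype.card_pos
  set n : ℝ := ((Fintype.card ι : ℕ) : ℝ) with hn_def
  set u := Real.sqrt (n / lam) with hu_def
  have hu : 0 < u := Real.sqrt_pos.2 (by positivity)
  have hu2 : u * u = n / lam := Real.mul_self_sqrt (by positivity)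
  have he : etaOf n u ≤ lam := by
    rw [etaOf, div_le_iff₀ (by positivity)]
    have : lam * (u * u) = n := by rw [hu2]; field_simp
    nlinarith [mul_pos hlam hu]
  have he0 := etaOf_pos hn hu
  have hT0 := meanTrace_nonneg A (show 0 < 5 * lam + etaOf n u by linarith)
  have hT : meanTrace A (5 * lam + etaOf n u) ≤ u := by
    refine le_of_mul_one_add_le hu.le ?_
    have h1 := meanTrace_le_card hlam.le hA (η := 5 * lam + etaOf n u) (by linarith) (by linarith)
    rw [add_sub_cancel_left, etaOf, mul_assoc, div_mul_eq_mul_div, ← hn_def,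
      div_le_iff₀ (by positivity)] at h1
    exact le_of_mul_le_mul_left h1 hn
  refine ⟨5 * lam + etaOf n u, by linarith, by linarith, le_meanLogDet hlam.le hA hu, ?_⟩
  have h2 : Real.sqrt (lam * n) = lam * u := by
    rw [show lam * n = (lam * u) * (lam * u) by rw [mul_mul_mul_comm, hu2]; field_simp,
      Real.sqrt_mul_self (by positivity)]
  rw [h2]
  nlinarith

theorem exists_meanLogDet_le {A : Matrix ι ι ℝ} {lam : ℝ} (hlam : 0 < lam)
    (hlamn : lam ≤ Fintype.card ι) (hA : IsProfile A lam) : ∃ η : ℝ, 0 < η ∧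
      meanLogDet A η ≤ Fintype.card ι * Real.log (Fintype.card ι) - Fintype.card ι
        + 4 * Real.sqrt (lam * Fintype.card ι) := by
  have hn : (0 : ℝ) < Fintype.card ι := by exact_mod_cast Fintype.card_pos
  set n : ℝ := ((Fintype.card ι : ℕ) : ℝ) with hn_def
  set w := Real.sqrt (n / lam) with hw_def
  have hw : 0 < w := Real.sqrt_pos.2 (by positivity)
  have hw2 : w * w = n / lam := Real.mul_self_sqrt (by positivity)
  have hw3 : lam * (w * w) = n := by rw [hw2]; field_simp
  have hw1 : 1 ≤ w := by rw [hw_def, Real.one_le_sqrt, one_le_div hlam]; exact hlamn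
  have hu : 0 < w / 2 := by positivity
  have hun : w / 2 * (1 + w / 2) * lam < n := by nlinarith [mul_pos hlam hw]
  refine ⟨etaOf n (w / 2) - lam, ?_, (meanLogDet_le_of_lt hlam hA hu hun).trans_eq ?_⟩
  · rw [sub_pos, etaOf, lt_div_iff₀ (by positivity)]; linarith
  · have h2 : Real.sqrt (lam * n) = lam * w := by
      rw [show lam * n = (lam * w) * (lam * w) by rw [mul_mul_mul_comm, hw2]; field_simp,
        Real.sqrt_mul_self (by positivity)]
    rw [h2, ← hn_def, add_right_inj, ← hw3]
    field_simp; norm_num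

end MeanLogDet

section NegativeMoment

open scoped ENNReal

theorem gaussianReal_zero_one_le_volume : gaussianReal 0 1 ≤ (volume : Measure ℝ) := by
  rw [gaussianReal_of_var_ne_zero _ one_ne_zero]
  calc volume.withDensity (gaussianPDF 0 1) ≤ (volume : Measure ℝ).withDensity 1 := by
        refine withDensity_mono (ae_of_all _ fun x => ?_)
        rw [gaussianPDF, Pi.one_apply, ENNReal.ofReal_le_one, gaussianPDFReal]
        refine mul_le_one₀ (inv_le_one_of_one_le₀ ?_) (Real.exp_nonneg _)
          (Real.exp_le_one_iff.2 ?_)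
        · rw [Real.one_le_sqrt, NNReal.coe_one]
          nlinarith [Real.pi_gt_three]
        · rw [NNReal.coe_one]
          exact div_nonpos_of_nonpos_of_nonneg (neg_nonpos.2 (sq_nonneg _)) (by norm_num)
    _ = volume := withDensity_one

theorem integrableOn_abs_rpow_neg_half :
    IntegrableOn (fun t : ℝ => |t| ^ (-(1 / 2) : ℝ)) (Set.Icc (-1) 1) := by
  have h0 : IntervalIntegrable (fun t : ℝ => |t| ^ (-(1 / 2) : ℝ)) volume 0 1 := by
    refine (intervalIntegral.intervalIntegrable_rpow' (r := -(1 / 2)) (by norm_num)).congr ?_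
    intro t ht
    rw [Set.uIoc_of_le zero_le_one] at ht
    simp only
    rw [abs_of_pos ht.1]
  have h1 : IntervalIntegrable (fun t : ℝ => |t| ^ (-(1 / 2) : ℝ)) volume (-1) 0 := by
    have := (IntervalIntegrable.iff_comp_neg).1 h0
    simpa using this.symm
  exact (intervalIntegrable_iff_integrableOn_Icc_of_le (by norm_num)).1 (h1.trans h0)

theorem exists_lintegral_abs_add_rpow_le :
    ∃ C : ℝ, 0 < C ∧ ∀ b : ℝ,
      ∫⁻ t, ENNReal.ofReal (|t + b| ^ (-(1 / 2) : ℝ)) ∂(gaussianReal 0 1)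
        ≤ ENNReal.ofReal C := by
  set F : ℝ → ℝ≥0∞ := (Set.Icc (-1 : ℝ) 1).indicator
    fun t => ENNReal.ofReal (|t| ^ (-(1 / 2) : ℝ)) with hF
  have hFm : Measurable F := Measurable.indicator (by fun_prop) measurableSet_Icc
  have hfin : ∫⁻ t, F t < ⊤ := by
    rw [lintegral_indicator measurableSet_Icc]
    refine lt_of_le_of_lt (lintegral_mono fun t => ?_)
      integrableOn_abs_rpow_neg_half.hasFiniteIntegral
    exact Real.ofReal_le_enorm _
  refine ⟨1 + (∫⁻ t, F t).toReal, by positivity, fun b => ?_⟩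
  have hpt : ∀ t : ℝ, ENNReal.ofReal (|t + b| ^ (-(1 / 2) : ℝ)) ≤ 1 + F (t + b) := fun t => by
    by_cases h : t + b ∈ Set.Icc (-1 : ℝ) 1
    · simp only [hF, Set.indicator_of_mem h]; exact le_add_self
    · refine le_add_right (ENNReal.ofReal_le_one.2 ?_)
      refine Real.rpow_le_one_of_one_le_of_nonpos ?_ (by norm_num)
      by_contra! hlt
      exact h (abs_le.1 hlt.le)
  calc ∫⁻ t, ENNReal.ofReal (|t + b| ^ (-(1 / 2) : ℝ)) ∂(gaussianReal 0 1)
      ≤ ∫⁻ t, (1 + F (t + b)) ∂(gaussianReal 0 1) := lintegral_mono hpt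
    _ = 1 + ∫⁻ t, F (t + b) ∂(gaussianReal 0 1) := by
        rw [lintegral_add_left measurable_const]; simp
    _ ≤ 1 + ∫⁻ t, F (t + b) := by
        gcongr; exact gaussianReal_zero_one_le_volume
    _ = 1 + ∫⁻ t, F t := by rw [lintegral_add_right_eq_self F b]
    _ = _ := by
        rw [ENNReal.ofReal_add zero_le_one ENNReal.toReal_nonneg,
          ENNReal.ofReal_toReal hfin.ne, ENNReal.ofReal_one]

end NegativeMoment

section Entry

open Matrix

variable {ι : Type*} [DecidableEq ι]

theorem profileMat_update_entry (A : Matrix ι ι ℝ) (g : ι → ι → ℝ) (j i : ι) (t : ℝ) :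
    profileMat A (Function.update g j (Function.update (g j) i t))
      = (profileMat A g).updateRow j
          (Function.update (profileMat A g j) i (Real.sqrt (A j i) * t)) := by
  ext a b
  by_cases ha : a = j
  · subst ha
    by_cases hb : b = i
    · subst hb; simp [profileMat]
    · simp [profileMat, hb]
  · simp [profileMat, ha]

/-- The matrix `X` with the rows outside `S` replaced by those of the identity. -/
def partialRows (S : Finset ι) (X : Matrix ι ι ℝ) : Matrix ι ι ℝ :=
  Matrix.of fun i j => if i ∈ S then X i j else (1 : Matrix ι ι ℝ) i j

theorem continuous_partialRows (S : Finset ι) :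
    Continuous (partialRows S : Matrix ι ι ℝ → Matrix ι ι ℝ) := by
  refine continuous_matrix fun i j => ?_
  by_cases h : i ∈ S
  · simpa [partialRows, h] using continuous_id.matrix_elem i j
  · simpa [partialRows, h] using continuous_const

theorem partialRows_insert_updateRow {S : Finset ι} (k : ι) (X : Matrix ι ι ℝ) (v : ι → ℝ) :
    partialRows (insert k S) (X.updateRow k v) = (partialRows (insert k S) X).updateRow k v := by
  ext a b
  by_cases ha : a = k
  · subst ha; simp [partialRows]
  · simp [partialRows, ha]

variable [Fintype ι]

theorem det_updateRow_update (X : Matrix ι ι ℝ) (j i : ι) (t : ℝ) :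
    (X.updateRow j (Function.update (X j) i t)).det
      = t * adjugate X i j + (X.updateRow j (Function.update (X j) i 0)).det := by
  have h : Function.update (X j) i t = t • Pi.single i (1 : ℝ) + Function.update (X j) i 0 := by
    funext l
    by_cases hl : l = i
    · subst hl; simp
    · simp [hl]
  rw [h, det_updateRow_add, det_updateRow_smul, adjugate_apply]

theorem adjugate_updateRow_self (X : Matrix ι ι ℝ) (j i : ι) (v : ι → ℝ) :
    adjugate (X.updateRow j v) i j = adjugate X i j := by
  rw [adjugate_apply, adjugate_apply, updateRow_idem]

theorem ae_gMat_of_forall_entry (i k : ι) {P : (ι → ι → ℝ) → Prop}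
    (hP : MeasurableSet {g | P g})
    (h : ∀ᵐ g ∂(gMat ι), ∀ᵐ t ∂(gaussianReal 0 1),
      P (Function.update g i (Function.update (g i) k t))) : ∀ᵐ g ∂(gMat ι), P g := by
  have hmp := measurePreserving_update_entry (ι := ι) i k
  rw [← hmp.map_eq, ae_map_iff hmp.measurable.aemeasurable hP]
  exact (Measure.ae_prod_iff_ae_ae (hmp.measurable hP)).2 h

theorem lintegral_gMat_eq_entry (i k : ι) {F : (ι → ι → ℝ) → ENNReal} (hF : Measurable F) :
    ∫⁻ g, F g ∂(gMat ι) = ∫⁻ g, ∫⁻ t,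
      F (Function.update g i (Function.update (g i) k t)) ∂(gaussianReal 0 1) ∂(gMat ι) := by
  have hmp := measurePreserving_update_entry (ι := ι) i k
  rw [← hmp.lintegral_comp hF]
  exact lintegral_prod _ (hF.comp hmp.measurable).aemeasurable

theorem adjugate_partialRows_insert {S : Finset ι} {k : ι} (hk : k ∉ S) (X : Matrix ι ι ℝ) :
    adjugate (partialRows (insert k S) X) k k = (partialRows S X).det := by
  rw [adjugate_apply]
  congr 1
  ext a b
  by_cases ha : a = k
  · subst ha
    rw [updateRow_self]
    simp only [partialRows, of_apply, hk, if_false]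
    rw [one_apply, Pi.single_apply]
    simp only [eq_comm]
  · simp [partialRows, ha]

theorem ae_det_partialRows_ne_zero (A : Matrix ι ι ℝ) (hA : ∀ i, 0 < A i i) (S : Finset ι) :
    ∀ᵐ g ∂(gMat ι), (partialRows S (profileMat A g)).det ≠ 0 := by
  induction S using Finset.induction_on with
  | empty =>
    refine ae_of_all _ fun g => ?_
    have : partialRows ∅ (profileMat A g) = 1 := by ext; simp [partialRows]
    simp [this]
  | insert k S hk ih =>
    refine ae_gMat_of_forall_entry k k ?_ ?_
    · have hc : Continuous fun g : ι → ι → ℝ =>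
          (partialRows (insert k S) (profileMat A g)).det :=
        ((continuous_partialRows _).comp (continuous_profileMat A)).matrix_det
      exact (hc.measurable (measurableSet_singleton 0)).compl
    · filter_upwards [ih] with g hg
      set Y := partialRows (insert k S) (profileMat A g) with hY
      have hYk : Y k = profileMat A g k := by funext l; simp [hY, partialRows]
      have hdet : ∀ t : ℝ, (partialRows (insert k S) (profileMat A
          (Function.update g k (Function.update (g k) k t)))).det =
          (Real.sqrt (A k k) * t) * (partialRows S (profileMat A g)).det +
            (Y.updateRow k (Function.update (Y k) k 0)).det := fun t => by
        rw [profileMat_update_entry, partialRows_insert_updateRow, ← hY, ← hYk,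
          det_updateRow_update, hY, adjugate_partialRows_insert hk]
      set d := (partialRows S (profileMat A g)).det
      set b := (Y.updateRow k (Function.update (Y k) k 0)).det
      have hs : Real.sqrt (A k k) ≠ 0 := (Real.sqrt_pos.2 (hA k)).ne'
      have hsub : ∀ t : ℝ, t ≠ -b / (Real.sqrt (A k k) * d) →
          (partialRows (insert k S) (profileMat A
            (Function.update g k (Function.update (g k) k t)))).det ≠ 0 := fun t ht h0 => by
        rw [hdet t] at h0
        apply ht
        rw [eq_div_iff (mul_ne_zero hs hg)]
        linarith
      have hne : ∀ᵐ t ∂(gaussianReal 0 1), t ≠ -b / (Real.sqrt (A k k) * d) := by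
        have := nullSingletonClass_gaussianReal (μ := 0) (v := 1) one_ne_zero
        exact compl_mem_ae_iff.2 (measure_singleton _)
      filter_upwards [hne] with t ht using hsub t ht

theorem ae_det_profileMat_ne_zero (A : Matrix ι ι ℝ) (hA : ∀ i, 0 < A i i) :
    ∀ᵐ g ∂(gMat ι), (profileMat A g).det ≠ 0 := by
  filter_upwards [ae_det_partialRows_ne_zero A hA Finset.univ] with g hg
  have : partialRows Finset.univ (profileMat A g) = profileMat A g := by ext; simp [partialRows]
  rwa [this] at hg

theorem inv_apply_eq_adjugate_div (X : Matrix ι ι ℝ) (i j : ι) :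
    X⁻¹ i j = adjugate X i j / X.det := by
  rw [inv_def, Ring.inverse_eq_inv', Matrix.smul_apply, smul_eq_mul, inv_mul_eq_div]

theorem measurable_inv_profileMat (A : Matrix ι ι ℝ) (i j : ι) :
    Measurable fun g => (profileMat A g)⁻¹ i j := by
  simp_rw [inv_apply_eq_adjugate_div]
  exact ((continuous_profileMat A).matrix_adjugate.matrix_elem i j).measurable.div
    (continuous_profileMat A).matrix_det.measurable

theorem exists_lintegral_inv_apply_le : ∃ C : ℝ, 0 < C ∧
    ∀ (ι : Type) [Fintype ι] [DecidableEq ι] (A : Matrix ι ι ℝ) (ε : ℝ), 0 < ε →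
      (∀ i j, ε ≤ A i j) → ∀ i j : ι,
      ∫⁻ g, ENNReal.ofReal (|(profileMat A g)⁻¹ i j| ^ (1 / 2 : ℝ)) ∂(gMat ι)
        ≤ ENNReal.ofReal (C * ε ^ (-(1 / 4) : ℝ)) := by
  obtain ⟨C, hC, hb⟩ := exists_lintegral_abs_add_rpow_le
  refine ⟨C, hC, fun ι _ _ A ε hε hA i j => ?_⟩
  rw [lintegral_gMat_eq_entry j i ((measurable_inv_profileMat A i j).abs.pow_const
    _).ennreal_ofReal]
  calc _ ≤ ∫⁻ _g : ι → ι → ℝ, ENNReal.ofReal (C * ε ^ (-(1 / 4) : ℝ)) ∂(gMat ι) := by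
        refine lintegral_mono fun g => ?_
        set X := profileMat A g
        set α := adjugate X i j with hα
        set b := (X.updateRow j (Function.update (X j) i 0)).det
        set r := Real.sqrt (A j i) with hr
        have hr0 : 0 < r := Real.sqrt_pos.2 (hε.trans_le (hA j i))
        have hval : ∀ t : ℝ, (profileMat A
            (Function.update g j (Function.update (g j) i t)))⁻¹ i j
              = α / (r * t * α + b) := fun t => by
          rw [inv_apply_eq_adjugate_div, profileMat_update_entry, adjugate_updateRow_self,
            det_updateRow_update]
        simp only [hval]
        by_cases hα0 : α = 0
        · simp [hα0]
        · have hpt : ∀ t : ℝ, |α / (r * t * α + b)| ^ (1 / 2 : ℝ)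
              = r ^ (-(1 / 2) : ℝ) * |t + b / (r * α)| ^ (-(1 / 2) : ℝ) := fun t => by
            rw [show α / (r * t * α + b) = (r * (t + b / (r * α)))⁻¹ by field_simp,
              abs_inv, abs_mul, abs_of_pos hr0, Real.inv_rpow (by positivity),
              ← Real.rpow_neg (by positivity), Real.mul_rpow hr0.le (abs_nonneg _)]
          simp only [hpt]
          have hε' : r ^ (-(1 / 2) : ℝ) ≤ ε ^ (-(1 / 4) : ℝ) := by
            rw [hr, Real.sqrt_eq_rpow, ← Real.rpow_mul (hε.le.trans (hA j i))]
            norm_num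
            exact Real.rpow_le_rpow_of_nonpos hε (hA j i) (by norm_num)
          simp_rw [ENNReal.ofReal_mul (Real.rpow_nonneg hr0.le _)]
          rw [lintegral_const_mul _ (by fun_prop), mul_comm C,
            ENNReal.ofReal_mul (Real.rpow_nonneg hε.le _)]
          gcongr
          exact hb _
    _ = _ := by simp

end Entry

section Gap

open Matrix

theorem log_one_add_sum_le {κ : Type*} (s : Finset κ) {a : κ → ℝ} (ha : ∀ i, 0 ≤ a i) :
    Real.log (1 + ∑ i ∈ s, a i) ≤ ∑ i ∈ s, Real.log (1 + a i) := by
  classical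
  induction s using Finset.induction_on with
  | empty => simp
  | insert k s hk ih =>
    have h0 := ha k
    have h1 : 0 ≤ ∑ i ∈ s, a i := Finset.sum_nonneg fun i _ => ha i
    rw [Finset.sum_insert hk, Finset.sum_insert hk]
    calc Real.log (1 + (a k + ∑ i ∈ s, a i))
        ≤ Real.log ((1 + a k) * (1 + ∑ i ∈ s, a i)) :=
          Real.log_le_log (by positivity) (by nlinarith)
      _ = Real.log (1 + a k) + Real.log (1 + ∑ i ∈ s, a i) :=
          Real.log_mul (by positivity) (by positivity)
      _ ≤ _ := by linarith

theorem log_one_add_mul_sq_le {η : ℝ} (hη : 0 ≤ η) (x : ℝ) :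
    Real.log (1 + η * x ^ 2) ≤ 4 * (η ^ (1 / 4 : ℝ) * |x| ^ (1 / 2 : ℝ)) := by
  set y := η ^ (1 / 4 : ℝ) * |x| ^ (1 / 2 : ℝ) with hy
  have hy0 : 0 ≤ y := by positivity
  have h1 : η * x ^ 2 = y ^ 4 := by
    rw [hy, mul_pow, ← Real.rpow_mul_natCast hη, ← Real.rpow_mul_natCast (abs_nonneg x),
      ← sq_abs, ← Real.rpow_natCast |x| 2]
    norm_num
  rw [h1]
  calc Real.log (1 + y ^ 4) ≤ Real.log ((1 + y) ^ 4) := by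
        refine Real.log_le_log (by positivity) ?_
        have : (1 + y) ^ 4 = 1 + y ^ 4 + (4 * y + 6 * y ^ 2 + 4 * y ^ 3) := by ring
        rw [this]
        linarith [show 0 ≤ 4 * y + 6 * y ^ 2 + 4 * y ^ 3 by positivity]
    _ = 4 * Real.log (1 + y) := by rw [Real.log_pow]; norm_num
    _ ≤ 4 * y := by
        linarith [Real.log_le_sub_one_of_pos (show 0 < 1 + y by positivity)]

variable {ι : Type*} [Fintype ι] [DecidableEq ι]

theorem trace_gramInv_zero (X : Matrix ι ι ℝ) :
    (gramInv X 0).trace = ∑ i, ∑ j, X⁻¹ i j ^ 2 := by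
  rw [gramInv, zero_smul, zero_add, Matrix.mul_inv_rev, ← transpose_nonsing_inv, Finset.sum_comm]
  simp only [Matrix.trace, Matrix.diag, Matrix.mul_apply, transpose_apply, sq]

theorem exists_log_det_sq_eq_sum {X : Matrix ι ι ℝ} (hX : X.det ≠ 0) :
    ∃ ev : ι → ℝ, (∀ i, 0 < ev i) ∧ Real.log (X.det ^ 2) = ∑ i, Real.log (ev i) ∧
      ∑ i, 1 / ev i = ∑ i, ∑ j, X⁻¹ i j ^ 2 ∧
      ∀ η, 0 < η → logDet X η = ∑ i, Real.log (η + ev i) := by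
  obtain ⟨ev, hev, -, h⟩ := det_and_trace_eigenvalues X
  have hdet : X.det ^ 2 = ∏ i, ev i := by
    have := (h 0).1
    simpa [det_mul, det_transpose, sq] using this
  have hpos : ∀ i, 0 < ev i := fun i => (hev i).lt_of_ne' fun h0 => by
    rw [Finset.prod_eq_zero (Finset.mem_univ i) h0] at hdet
    exact hX (pow_eq_zero_iff two_ne_zero |>.1 hdet)
  refine ⟨ev, hpos, ?_, ?_, fun η hη => ?_⟩
  · rw [hdet, Real.log_prod fun i _ => (hpos i).ne']
  · rw [← trace_gramInv_zero, (h 0).2 fun i => by simpa using (hpos i).ne']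
    simp
  · rw [logDet, (h η).1, Real.log_prod fun i _ => (add_pos hη (hpos i)).ne']

theorem log_det_sq_le_logDet {X : Matrix ι ι ℝ} (hX : X.det ≠ 0) {η : ℝ} (hη : 0 < η) :
    Real.log (X.det ^ 2) ≤ logDet X η := by
  obtain ⟨ev, hpos, h1, -, h2⟩ := exists_log_det_sq_eq_sum hX
  rw [h1, h2 η hη]
  exact Finset.sum_le_sum fun i _ => Real.log_le_log (hpos i) (by linarith)

/-- A bound on the change of the log-determinant under regularization, in terms of the inverse. -/
def gapBound (X : Matrix ι ι ℝ) (η : ℝ) : ℝ :=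
  Fintype.card ι * ∑ i, ∑ j, 4 * (η ^ (1 / 4 : ℝ) * |X⁻¹ i j| ^ (1 / 2 : ℝ))

theorem logDet_le_log_det_sq_add {X : Matrix ι ι ℝ} (hX : X.det ≠ 0) {η : ℝ} (hη : 0 < η) :
    logDet X η ≤ Real.log (X.det ^ 2) + gapBound X η := by
  obtain ⟨ev, hpos, h1, h3, h2⟩ := exists_log_det_sq_eq_sum hX
  have hS : Real.log (1 + η * ∑ i, ∑ j, X⁻¹ i j ^ 2)
      ≤ ∑ i, ∑ j, 4 * (η ^ (1 / 4 : ℝ) * |X⁻¹ i j| ^ (1 / 2 : ℝ)) := by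
    simp only [Finset.mul_sum]
    have hnn : ∀ i j, 0 ≤ η * X⁻¹ i j ^ 2 := fun i j => by positivity
    refine (log_one_add_sum_le _ fun i => Finset.sum_nonneg fun j _ => hnn i j).trans
      (Finset.sum_le_sum fun i _ => ?_)
    refine (log_one_add_sum_le _ fun j => hnn i j).trans (Finset.sum_le_sum fun j _ => ?_)
    exact log_one_add_mul_sq_le hη.le _
  have hterm : ∀ i, Real.log (η + ev i) ≤ Real.log (ev i) +
      ∑ i, ∑ j, 4 * (η ^ (1 / 4 : ℝ) * |X⁻¹ i j| ^ (1 / 2 : ℝ)) := fun i => by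
    have h4 : η + ev i = ev i * (1 + η * (1 / ev i)) := by
      have := (hpos i).ne'
      field_simp; ring
    have h5 : 1 / ev i ≤ ∑ i, 1 / ev i :=
      Finset.single_le_sum (f := fun i => 1 / ev i) (fun i _ => (one_div_pos.2 (hpos i)).le)
        (Finset.mem_univ i)
    have h6 : 0 < 1 / ev i := one_div_pos.2 (hpos i)
    rw [h4, Real.log_mul (hpos i).ne' (by positivity)]
    refine add_le_add_right ((Real.log_le_log (by positivity) ?_).trans hS) _
    rw [← h3]
    gcongr
  rw [h1, h2 η hη]
  refine (Finset.sum_le_sum fun i _ => hterm i).trans_eq ?_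
  rw [Finset.sum_add_distrib, Finset.sum_const, Finset.card_univ, nsmul_eq_mul, gapBound]

theorem logDet_sub_le (X : Matrix ι ι ℝ) {η η' : ℝ} (hη' : 0 < η') (hle : η' ≤ η) :
    logDet X η - logDet X η' ≤ Real.log (η / η') * (η * (gramInv X η).trace) := by
  have hη : 0 < η := hη'.trans_le hle
  obtain ⟨ev, hev, -, h⟩ := exists_logDet_eq_sum X
  rw [(h η hη).1, (h η' hη').1, (h η hη).2, ← Finset.sum_sub_distrib, Finset.mul_sum,
    Finset.mul_sum]
  refine Finset.sum_le_sum fun i _ => ?_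
  have h0 := hev i
  set p := η * (1 / (η + ev i)) with hp
  have hp0 : 0 ≤ p := by positivity
  have hp1 : p ≤ 1 := by
    rw [hp, mul_one_div, div_le_one (by positivity)]; linarith
  have hr : 0 < η' / η := by positivity
  have hconc := strictConcaveOn_log_Ioi.concaveOn.2 (show η' / η ∈ Set.Ioi 0 from hr)
    (show (1 : ℝ) ∈ Set.Ioi 0 from Set.mem_Ioi.2 one_pos) hp0 (sub_nonneg.2 hp1) (by ring)
  simp only [smul_eq_mul, Real.log_one, mul_zero, add_zero, mul_one] at hconc
  have heq : p * (η' / η) + (1 - p) = (η' + ev i) / (η + ev i) := by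
    rw [hp]; field_simp; ring
  rw [heq, Real.log_div hη'.ne' hη.ne', Real.log_div (by positivity) (by positivity)] at hconc
  rw [Real.log_div hη.ne' hη'.ne']
  linarith

theorem meanLogDet_sub_le (A : Matrix ι ι ℝ) (hA : ∀ i j, 0 ≤ A i j) {η η' : ℝ} (hpos : 0 < η')
    (hle : η' ≤ η) :
    meanLogDet A η - meanLogDet A η' ≤ Real.log (η / η') * (η * meanTrace A η) := by
  have hη : 0 < η := hpos.trans_le hle
  have hT : Integrable (fun g => (gramInv (profileMat A g) η).trace) (gMat ι) :=
    integrable_finsetSum _ fun i _ => integrable_gramInv_diag A hη i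
  rw [meanLogDet, meanLogDet, ← integral_sub (integrable_logDet_profileMat A hA hη)
    (integrable_logDet_profileMat A hA hpos), meanTrace, ← integral_const_mul,
    ← integral_const_mul]
  exact integral_mono ((integrable_logDet_profileMat A hA hη).sub
    (integrable_logDet_profileMat A hA hpos)) ((hT.const_mul _).const_mul _)
    fun g => logDet_sub_le _ hpos hle

/-- The logarithm of the squared determinant of the Gaussian matrix with variance profile `A`. -/
def logDetSq (A : Matrix ι ι ℝ) (g : ι → ι → ℝ) : ℝ := Real.log ((profileMat A g).det ^ 2)

theorem measurable_logDetSq (A : Matrix ι ι ℝ) : Measurable (logDetSq A) :=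
  ((continuous_profileMat A).matrix_det.pow 2).measurable.log

theorem gapBound_nonneg (X : Matrix ι ι ℝ) {η : ℝ} (hη : 0 ≤ η) : 0 ≤ gapBound X η := by
  unfold gapBound; positivity

end Gap

section MeanEstimate

variable {ι : Type} [Fintype ι] [DecidableEq ι]

theorem integral_gapBound_le {A : Matrix ι ι ℝ} {K : ℝ} (hK : 0 ≤ K)
    (hinv : ∀ i j : ι, ∫⁻ g, ENNReal.ofReal (|(profileMat A g)⁻¹ i j| ^ (1 / 2 : ℝ)) ∂(gMat ι)
      ≤ ENNReal.ofReal K) {η : ℝ} (hη : 0 ≤ η) :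
    Integrable (fun g => gapBound (profileMat A g) η) (gMat ι) ∧
      ∫ g, gapBound (profileMat A g) η ∂(gMat ι)
        ≤ 4 * K * (Fintype.card ι : ℝ) ^ 3 * η ^ (1 / 4 : ℝ) := by
  have hm : ∀ i j : ι, Measurable fun g => |(profileMat A g)⁻¹ i j| ^ (1 / 2 : ℝ) := fun i j =>
    (measurable_inv_profileMat A i j).abs.pow_const _
  have hnn : ∀ i j : ι, ∀ g, 0 ≤ |(profileMat A g)⁻¹ i j| ^ (1 / 2 : ℝ) := fun i j g => by
    positivity
  have hint : ∀ i j : ι,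
      Integrable (fun g => |(profileMat A g)⁻¹ i j| ^ (1 / 2 : ℝ)) (gMat ι) := fun i j =>
    ⟨(hm i j).aestronglyMeasurable, by
      rw [hasFiniteIntegral_iff_ofReal (ae_of_all _ (hnn i j))]
      exact (hinv i j).trans_lt ENNReal.ofReal_lt_top⟩
  have hle : ∀ i j : ι, ∫ g, |(profileMat A g)⁻¹ i j| ^ (1 / 2 : ℝ) ∂(gMat ι) ≤ K :=
      fun i j => by
    rw [integral_eq_lintegral_of_nonneg_ae (ae_of_all _ (hnn i j)) (hm i j).aestronglyMeasurable]
    exact ENNReal.toReal_le_of_le_ofReal hK (hinv i j)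
  have hint' : ∀ i j : ι, Integrable (fun g => 4 * (η ^ (1 / 4 : ℝ) *
      |(profileMat A g)⁻¹ i j| ^ (1 / 2 : ℝ))) (gMat ι) := fun i j =>
    ((hint i j).const_mul _).const_mul _
  refine ⟨(integrable_finsetSum _ fun i _ => integrable_finsetSum _ fun j _ =>
    hint' i j).const_mul _, ?_⟩
  calc ∫ g, gapBound (profileMat A g) η ∂(gMat ι)
      = Fintype.card ι * ∑ i : ι, ∑ j : ι, 4 * (η ^ (1 / 4 : ℝ) *
          ∫ g, |(profileMat A g)⁻¹ i j| ^ (1 / 2 : ℝ) ∂(gMat ι)) := by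
        unfold gapBound
        rw [integral_const_mul, integral_finsetSum _ fun i _ => integrable_finsetSum _ fun j _ =>
          hint' i j]
        congr 1
        refine Finset.sum_congr rfl fun i _ => ?_
        rw [integral_finsetSum _ fun j _ => hint' i j]
        refine Finset.sum_congr rfl fun j _ => ?_
        rw [integral_const_mul, integral_const_mul]
    _ ≤ Fintype.card ι * ∑ _i : ι, ∑ _j : ι, 4 * (η ^ (1 / 4 : ℝ) * K) := by
        gcongr with i _ j _
        exact hle i j
    _ = _ := by
        simp only [Finset.sum_const, Finset.card_univ, nsmul_eq_mul]
        ring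

theorem integrable_logDetSq {A : Matrix ι ι ℝ} (hA : ∀ i j, 0 < A i j) {K : ℝ} (hK : 0 ≤ K)
    (hinv : ∀ i j : ι, ∫⁻ g, ENNReal.ofReal (|(profileMat A g)⁻¹ i j| ^ (1 / 2 : ℝ)) ∂(gMat ι)
      ≤ ENNReal.ofReal K) : Integrable (logDetSq A) (gMat ι) := by
  have hA' : ∀ i j, 0 ≤ A i j := fun i j => (hA i j).le
  refine Integrable.mono' ((integrable_logDet_profileMat A hA' one_pos).abs.add
    (integral_gapBound_le hK hinv zero_le_one).1) (measurable_logDetSq A).aestronglyMeasurable ?_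
  filter_upwards [ae_det_profileMat_ne_zero A fun i => hA i i] with g hg
  have h1 := log_det_sq_le_logDet hg one_pos
  have h2 := logDet_le_log_det_sq_add hg one_pos
  have h3 := gapBound_nonneg (profileMat A g) zero_le_one
  have h4 := abs_le.1 (le_refl |logDet (profileMat A g) 1|)
  rw [Real.norm_eq_abs, Pi.add_apply, logDetSq, abs_le]
  constructor <;> linarith [h4.1, h4.2]

theorem integral_logDetSq_le [Nonempty ι] {A : Matrix ι ι ℝ} (hA : ∀ i j, 0 < A i j) {lam : ℝ}
    (hlam : 0 < lam) (hlamn : lam ≤ Fintype.card ι) (hP : IsProfile A lam)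
    (hint : Integrable (logDetSq A) (gMat ι)) :
    ∫ g, logDetSq A g ∂(gMat ι) ≤ Fintype.card ι * Real.log (Fintype.card ι) - Fintype.card ι
        + 4 * Real.sqrt (lam * Fintype.card ι) := by
  obtain ⟨η, hη, h⟩ := exists_meanLogDet_le hlam hlamn hP
  refine (integral_mono_ae hint (integrable_logDet_profileMat A hP.nonneg hη) ?_).trans h
  filter_upwards [ae_det_profileMat_ne_zero A fun i => hA i i] with g hg
  exact log_det_sq_le_logDet hg hη

theorem le_integral_logDetSq [Nonempty ι] {A : Matrix ι ι ℝ} (hA : ∀ i j, 0 < A i j) {lam : ℝ}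
    (hlam : 1 ≤ lam) (hP : IsProfile A lam) {K : ℝ} (hK : 0 ≤ K)
    (hinv : ∀ i j : ι, ∫⁻ g, ENNReal.ofReal (|(profileMat A g)⁻¹ i j| ^ (1 / 2 : ℝ)) ∂(gMat ι)
      ≤ ENNReal.ofReal K)
    (hint : Integrable (logDetSq A) (gMat ι)) :
    Fintype.card ι * Real.log (Fintype.card ι) - Fintype.card ι
        - 6 * Real.log (6 * lam * (Fintype.card ι : ℝ) ^ 12) * Real.sqrt (lam * Fintype.card ι)
        - 4 * K ≤ ∫ g, logDetSq A g ∂(gMat ι) := by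
  have hn : (1 : ℝ) ≤ Fintype.card ι := by exact_mod_cast Fintype.card_pos
  obtain ⟨η, hη5, hη6, h1, h2⟩ := exists_eta_le_meanLogDet (by linarith) hP
  set n : ℝ := ((Fintype.card ι : ℕ) : ℝ) with hn_def
  have hη : 0 < η := by linarith
  set η' : ℝ := 1 / n ^ 12 with hη'_def
  have hη' : 0 < η' := by positivity
  have hη'1 : η' ≤ 1 := by
    rw [hη'_def, div_le_one (by positivity)]; exact one_le_pow₀ hn
  have h3 := meanLogDet_sub_le A hP.nonneg hη' (by linarith : η' ≤ η)
  have hlog : Real.log (η / η') ≤ Real.log (6 * lam * n ^ 12) := by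
    refine Real.log_le_log (by positivity) ?_
    rw [hη'_def, div_div_eq_mul_div, div_one]
    gcongr
  have hlog0 : 0 ≤ Real.log (η / η') :=
    Real.log_nonneg (by rw [one_le_div hη']; linarith)
  have h4 : Real.log (η / η') * (η * meanTrace A η)
      ≤ Real.log (6 * lam * n ^ 12) * (6 * Real.sqrt (lam * n)) :=
    mul_le_mul hlog h2 (mul_nonneg hη.le (meanTrace_nonneg A hη)) (hlog0.trans hlog)
  obtain ⟨hgi, hgap⟩ := integral_gapBound_le hK hinv hη'.le
  have h5 : 4 * K * n ^ 3 * η' ^ (1 / 4 : ℝ) = 4 * K := by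
    have h6 : η' ^ (1 / 4 : ℝ) = 1 / n ^ 3 := by
      rw [hη'_def, show 1 / n ^ 12 = (1 / n ^ 3) ^ (4 : ℕ) by rw [one_div_pow, ← pow_mul],
        ← Real.rpow_natCast, ← Real.rpow_mul (by positivity)]
      norm_num
    rw [h6]; field_simp
  have h7 : meanLogDet A η' ≤ ∫ g, (logDetSq A g + gapBound (profileMat A g) η') ∂(gMat ι) := by
    refine integral_mono_ae (integrable_logDet_profileMat A hP.nonneg hη') (hint.add hgi) ?_
    filter_upwards [ae_det_profileMat_ne_zero A fun i => hA i i] with g hg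
    exact logDet_le_log_det_sq_add hg hη'
  rw [integral_add hint hgi] at h7
  linarith

end MeanEstimate

section Tensorization

open Function

theorem eq_of_forall_update {ι β : Type*} [Fintype ι] [DecidableEq ι] {f : (ι → β) → ℝ}
    (h : ∀ k x t, f (update x k t) = f x) (x y : ι → β) : f y = f x := by
  have key : ∀ S : Finset ι, f (S.piecewise y x) = f x := fun S => by
    induction S using Finset.induction_on with
    | empty => simp
    | insert k S _ ih => rw [Finset.piecewise_insert, h, ih]
  simpa using key Finset.univ

variable {ι : Type*} [DecidableEq ι] {α : Type*} [MeasurableSpace α]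

theorem integrable_exp_mul_of_bound {Ω : Type*} [MeasurableSpace Ω] {P : Measure Ω}
    [IsFiniteMeasure P] {F : Ω → ℝ} (hF : Measurable F) {B : ℝ} (hB : ∀ x, |F x| ≤ B) (θ : ℝ) :
    Integrable (fun x => Real.exp (θ * F x)) P := by
  refine Integrable.of_bound (by fun_prop) (Real.exp (|θ| * B)) (ae_of_all _ fun x => ?_)
  rw [Real.norm_of_nonneg (Real.exp_nonneg _), Real.exp_le_exp]
  calc θ * F x ≤ |θ * F x| := le_abs_self _
    _ = |θ| * |F x| := abs_mul _ _
    _ ≤ _ := by gcongr; exact hB x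

theorem exp_integral_le {Ω : Type*} [MeasurableSpace Ω] {P : Measure Ω}
    [IsProbabilityMeasure P] {F : Ω → ℝ} (hF : Measurable F) {B : ℝ} (hB : ∀ x, |F x| ≤ B) :
    Real.exp (∫ x, F x ∂P) ≤ ∫ x, Real.exp (F x) ∂P := by
  have hi : Integrable F P := Integrable.of_bound hF.aestronglyMeasurable B (ae_of_all _ hB)
  have hi2 := integrable_exp_mul_of_bound (P := P) hF hB 1
  simp only [one_mul] at hi2
  exact convexOn_exp.map_integral_le Real.continuous_exp.continuousOn isClosed_univ
    (ae_of_all _ fun _ => Set.mem_univ _) hi hi2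

/-- A bounded measurable function on a product space all of whose one-coordinate slices have
symmetrized exponential moment at most `M`. -/
structure SymmExpBound (μ : Measure α) (θ M : ℝ) (f : (ι → α) → ℝ) : Prop where
  measurable : Measurable f
  bounded : ∃ B, ∀ x, |f x| ≤ B
  bound : ∀ i x, ∫ p, Real.exp (θ * (f (update x i p.1) - f (update x i p.2))) ∂(μ.prod μ) ≤ M

/-- The average of `f` over the coordinate `k`. -/
def coordAvg (μ : Measure α) (k : ι) (f : (ι → α) → ℝ) (x : ι → α) : ℝ :=
  ∫ t, f (update x k t) ∂μ

theorem measurable_coordAvg (μ : Measure α) [SFinite μ] (k : ι) {f : (ι → α) → ℝ}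
    (hf : Measurable f) : Measurable (coordAvg μ k f) :=
  (StronglyMeasurable.integral_prod_right' (f := fun p : (ι → α) × α => f (update p.1 k p.2))
    (hf.comp measurable_update').stronglyMeasurable).measurable

theorem abs_coordAvg_le (μ : Measure α) [IsProbabilityMeasure μ] (k : ι) {f : (ι → α) → ℝ}
    {B : ℝ} (hB : ∀ x, |f x| ≤ B) (x : ι → α) : |coordAvg μ k f x| ≤ B := by
  have := norm_integral_le_of_norm_le_const (μ := μ) (f := fun t => f (update x k t))
    (ae_of_all _ fun t => hB _)
  simpa [coordAvg] using this

theorem coordAvg_update_self (μ : Measure α) (k : ι) (f : (ι → α) → ℝ) (x : ι → α) (t : α) :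
    coordAvg μ k f (update x k t) = coordAvg μ k f x := by
  simp [coordAvg]

theorem coordAvg_update_of_ne (μ : Measure α) {k i : ι} (h : i ≠ k) (f : (ι → α) → ℝ)
    (x : ι → α) (t : α) :
    coordAvg μ k f (update x i t) = ∫ r, f (update (update x k r) i t) ∂μ := by
  simp only [coordAvg]
  congr 1; funext r
  rw [update_comm h.symm]

theorem SymmExpBound.coordAvg {μ : Measure α} [IsProbabilityMeasure μ] {θ M : ℝ} (hM : 1 ≤ M)
    {f : (ι → α) → ℝ} (hf : SymmExpBound μ θ M f) (k : ι) :
    SymmExpBound μ θ M (coordAvg μ k f) := by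
  obtain ⟨B, hB⟩ := hf.bounded
  refine ⟨measurable_coordAvg μ k hf.measurable, ⟨B, abs_coordAvg_le μ k hB⟩, fun i x => ?_⟩
  by_cases hik : i = k
  · subst hik
    simpa [coordAvg_update_self] using hM
  have hm1 : ∀ q : ι → α, ∀ j : ι, Measurable fun t : α => f (update q j t) := fun q j =>
    hf.measurable.comp (measurable_update q)
  have hd : ∀ q q' : ι → α, |f q - f q'| ≤ B + B := fun q q' =>
    (abs_sub _ _).trans (add_le_add (hB _) (hB _))
  have hm : Measurable fun z : (α × α) × α =>
      f (update (update x k z.2) i z.1.1) - f (update (update x k z.2) i z.1.2) := by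
    have h1 : Measurable fun z : (α × α) × α => update x k z.2 :=
      (measurable_update x).comp measurable_snd
    exact (hf.measurable.comp (measurable_update'.comp
        (h1.prodMk (measurable_fst.comp measurable_fst)))).sub
      (hf.measurable.comp (measurable_update'.comp
        (h1.prodMk (measurable_snd.comp measurable_fst))))
  have hint := integrable_exp_mul_of_bound (P := (μ.prod μ).prod μ) hm (fun z => hd _ _) θ
  calc ∫ p, Real.exp (θ * (GaussianDet.coordAvg μ k f (update x i p.1) -
        GaussianDet.coordAvg μ k f (update x i p.2))) ∂(μ.prod μ)
      ≤ ∫ p, ∫ r, Real.exp (θ * (f (update (update x k r) i p.1) -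
          f (update (update x k r) i p.2))) ∂μ ∂(μ.prod μ) := by
        refine integral_mono ?_ hint.integral_prod_left fun p => ?_
        · refine integrable_exp_mul_of_bound (B := B + B) ?_ (fun p => ?_) θ
          · exact ((measurable_coordAvg μ k hf.measurable).comp
              ((measurable_update x).comp measurable_fst)).sub
              ((measurable_coordAvg μ k hf.measurable).comp
              ((measurable_update x).comp measurable_snd))
          · exact (abs_sub _ _).trans (add_le_add (abs_coordAvg_le μ k hB _)
              (abs_coordAvg_le μ k hB _))
        · have hs : ∀ s : α, Measurable fun r => f (update (update x k r) i s) := fun s =>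
            hf.measurable.comp (measurable_update'.comp
              ((measurable_update x).prodMk measurable_const))
          have hi : ∀ s : α, Integrable (fun r => f (update (update x k r) i s)) μ := fun s =>
            Integrable.of_bound (hs s).aestronglyMeasurable B (ae_of_all _ fun r => hB _)
          simp only
          rw [coordAvg_update_of_ne μ hik, coordAvg_update_of_ne μ hik,
            ← integral_sub (hi _) (hi _), ← integral_const_mul]
          refine exp_integral_le (B := |θ| * (B + B)) (((hs _).sub (hs _)).const_mul θ)
            fun r => ?_
          rw [abs_mul]
          exact mul_le_mul_of_nonneg_left (hd _ _) (abs_nonneg _)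
    _ = ∫ r, ∫ p, Real.exp (θ * (f (update (update x k r) i p.1) -
          f (update (update x k r) i p.2))) ∂(μ.prod μ) ∂μ := integral_integral_swap hint
    _ ≤ ∫ _r, M ∂μ := integral_mono hint.integral_prod_right (integrable_const _)
        fun r => hf.bound i (update x k r)
    _ = M := by simp

theorem integral_exp_le_of_symm {μ : Measure α} [IsProbabilityMeasure μ] {F : α → ℝ}
    (hF : Measurable F) {B : ℝ} (hB : ∀ x, |F x| ≤ B) {θ M : ℝ}
    (h : ∫ p, Real.exp (θ * (F p.1 - F p.2)) ∂(μ.prod μ) ≤ M) :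
    ∫ s, Real.exp (θ * F s) ∂μ ≤ M * Real.exp (θ * ∫ s, F s ∂μ) := by
  have h1 : Real.exp (-θ * ∫ s, F s ∂μ) ≤ ∫ s, Real.exp (-θ * F s) ∂μ := by
    rw [← integral_const_mul]
    refine exp_integral_le (B := |θ| * B) (hF.const_mul _) fun x => ?_
    rw [abs_mul, abs_neg]
    exact mul_le_mul_of_nonneg_left (hB x) (abs_nonneg _)
  have h2 : (∫ s, Real.exp (θ * F s) ∂μ) * ∫ s, Real.exp (-θ * F s) ∂μ ≤ M := by
    rw [← integral_prod_mul]
    refine le_of_eq_of_le (integral_congr_ae (ae_of_all _ fun p => ?_)) h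
    simp only
    rw [← Real.exp_add]
    congr 1; ring
  have h3 : 0 ≤ ∫ s, Real.exp (θ * F s) ∂μ := integral_nonneg fun s => Real.exp_nonneg _
  have h4 : (∫ s, Real.exp (θ * F s) ∂μ) * Real.exp (-θ * ∫ s, F s ∂μ) ≤ M :=
    (mul_le_mul_of_nonneg_left h1 h3).trans h2
  rwa [neg_mul, Real.exp_neg, ← div_eq_mul_inv, div_le_iff₀ (Real.exp_pos _)] at h4

variable [Fintype ι]

theorem integral_coordAvg (μ : Measure α) [IsProbabilityMeasure μ] (k : ι) {f : (ι → α) → ℝ}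
    (hf : Integrable f (Measure.pi fun _ : ι => μ)) :
    ∫ x, coordAvg μ k f x ∂(Measure.pi fun _ : ι => μ) = ∫ x, f x ∂(Measure.pi fun _ : ι => μ) :=
  (integral_eq_of_measurePreserving_prod (measurePreserving_update μ k) hf).symm

theorem SymmExpBound.exists_average {μ : Measure α} [IsProbabilityMeasure μ] {θ M : ℝ}
    (hM : 1 ≤ M) {f : (ι → α) → ℝ} (hf : SymmExpBound μ θ M f) (S : Finset ι) :
    ∃ h : (ι → α) → ℝ, SymmExpBound μ θ M h ∧ (∀ k ∈ S, ∀ x t, h (update x k t) = h x) ∧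
      ∫ x, h x ∂(Measure.pi fun _ : ι => μ) = ∫ x, f x ∂(Measure.pi fun _ : ι => μ) ∧
      ∫ x, Real.exp (θ * f x) ∂(Measure.pi fun _ : ι => μ)
        ≤ M ^ S.card * ∫ x, Real.exp (θ * h x) ∂(Measure.pi fun _ : ι => μ) := by
  induction S using Finset.induction_on with
  | empty => exact ⟨f, hf, by simp, rfl, by simp⟩
  | insert k S hk ih =>
    obtain ⟨h, hh, hinv, hint, hle⟩ := ih
    obtain ⟨B, hB⟩ := hh.bounded
    have hi : Integrable h (Measure.pi fun _ : ι => μ) :=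
      Integrable.of_bound hh.measurable.aestronglyMeasurable B (ae_of_all _ hB)
    refine ⟨GaussianDet.coordAvg μ k h, hh.coordAvg hM k, fun j hj x t => ?_,
      (integral_coordAvg μ k hi).trans hint, hle.trans ?_⟩
    · by_cases hjk : j = k
      · subst hjk; exact coordAvg_update_self μ _ h x t
      · rw [coordAvg_update_of_ne μ hjk]
        simp only [hinv j ((Finset.mem_insert.1 hj).resolve_left hjk)]
        rfl
    · rw [Finset.card_insert_of_notMem hk, pow_succ, mul_assoc]
      refine mul_le_mul_of_nonneg_left ?_ (pow_nonneg (by linarith) _)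
      have hie := integrable_exp_mul_of_bound (P := Measure.pi fun _ : ι => μ) hh.measurable hB θ
      rw [← integral_coordAvg μ k hie, ← integral_const_mul]
      refine integral_mono ?_ ?_ fun x => ?_
      · refine Integrable.of_bound (measurable_coordAvg μ k
          (Real.measurable_exp.comp (hh.measurable.const_mul θ))).aestronglyMeasurable
          (Real.exp (|θ| * B)) (ae_of_all _ (abs_coordAvg_le μ k fun x => ?_))
        rw [abs_of_pos (Real.exp_pos _), Real.exp_le_exp]
        calc θ * h x ≤ |θ * h x| := le_abs_self _
          _ = |θ| * |h x| := abs_mul _ _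
          _ ≤ _ := by gcongr; exact hB x
      · exact (integrable_exp_mul_of_bound (measurable_coordAvg μ k hh.measurable)
          (abs_coordAvg_le μ k hB) θ).const_mul M
      · exact integral_exp_le_of_symm (hh.measurable.comp (measurable_update x))
          (fun t => hB _) (hh.bound k x)

theorem SymmExpBound.integral_exp_le [Nonempty α] {μ : Measure α} [IsProbabilityMeasure μ]
    {θ M : ℝ} (hM : 1 ≤ M) {f : (ι → α) → ℝ} (hf : SymmExpBound μ θ M f) :
    ∫ x, Real.exp (θ * (f x - ∫ y, f y ∂(Measure.pi fun _ : ι => μ)))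
      ∂(Measure.pi fun _ : ι => μ) ≤ M ^ Fintype.card ι := by
  obtain ⟨h, -, hinv, hint, hle⟩ := hf.exists_average hM Finset.univ
  obtain ⟨a⟩ := ‹Nonempty α›
  have hc : ∀ x, h x = h fun _ => a := fun x =>
    eq_of_forall_update (fun k x t => hinv k (Finset.mem_univ k) x t) _ x
  simp only [hc, integral_const, probReal_univ, one_smul] at hint hle
  rw [← hint]
  simp_rw [mul_sub, Real.exp_sub]
  rw [integral_div, div_le_iff₀ (Real.exp_pos _)]
  simpa using hle

end Tensorization

section Slice

/-- Truncation of a real number to the interval `[-N, N]`. -/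
def clip (N x : ℝ) : ℝ := max (-N) (min N x)

theorem measurable_clip (N : ℝ) : Measurable (clip N) := by unfold clip; fun_prop

theorem abs_clip_le {N : ℝ} (hN : 0 ≤ N) (x : ℝ) : |clip N x| ≤ N :=
  abs_le.2 ⟨le_max_left _ _, max_le (by linarith) (min_le_left _ _)⟩

theorem abs_clip_sub_clip_le (N x y : ℝ) : |clip N x - clip N y| ≤ |x - y| := by
  unfold clip
  rw [max_comm (-N), max_comm (-N)]
  refine (abs_max_sub_max_le_abs _ _ _).trans ((abs_min_sub_min_le_max _ _ _ _).trans ?_)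
  simp

theorem abs_clip_le_abs {N : ℝ} (hN : 0 ≤ N) (x : ℝ) : |clip N x| ≤ |x| := by
  have h0 : clip N 0 = 0 := by simp [clip, hN]
  simpa [h0] using abs_clip_sub_clip_le N x 0

theorem clip_of_abs_le {N x : ℝ} (h : |x| ≤ N) : clip N x = x := by
  obtain ⟨h1, h2⟩ := abs_le.1 h
  rw [clip, min_eq_right h2, max_eq_right h1]

theorem exp_le_one_add_add_sq_mul_exp (x : ℝ) :
    Real.exp x ≤ 1 + x + x ^ 2 * Real.exp |x| := by
  have key : ∀ y : ℝ, y * (Real.exp y - 1) ≤ y ^ 2 * Real.exp |y| := fun y => by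
    rcases le_total 0 y with hy | hy
    · have h1 : Real.exp y - 1 ≤ y * Real.exp y := by
        have h2 := Real.add_one_le_exp (-y)
        have h3 : Real.exp (-y) * Real.exp y = 1 := by rw [← Real.exp_add]; simp
        nlinarith [Real.exp_pos y]
      rw [abs_of_nonneg hy]
      nlinarith
    · have h1 : 1 ≤ Real.exp |y| := Real.one_le_exp (abs_nonneg _)
      have h2 := Real.add_one_le_exp y
      nlinarith [sq_nonneg y]
  have h2 := Real.add_one_le_exp (-x)
  have h3 : Real.exp (-x) * Real.exp x = 1 := by rw [← Real.exp_add]; simp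
  have h4 : Real.exp x ≤ 1 + x + x * (Real.exp x - 1) := by nlinarith [Real.exp_pos x]
  linarith [key x]

theorem exp_mul_le_of_abs_le {θ d D : ℝ} (hθ : |θ| ≤ 1 / 8) (hd : |d| ≤ D) :
    Real.exp (θ * d) ≤ 1 + θ * d + 128 * θ ^ 2 * Real.exp (D / 4) := by
  have h1 := exp_le_one_add_add_sq_mul_exp (θ * d)
  have hd0 := abs_nonneg d
  have h2 : |θ * d| ≤ D / 8 := by
    rw [abs_mul]
    nlinarith [abs_nonneg θ]
  have h3 : d ^ 2 ≤ 128 * Real.exp (D / 8) := by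
    have h4 := Real.quadratic_le_exp_of_nonneg (show 0 ≤ D / 8 by linarith)
    have h5 : d ^ 2 ≤ D ^ 2 := by rw [← sq_abs d]; gcongr
    nlinarith
  have h6 : Real.exp |θ * d| ≤ Real.exp (D / 8) := Real.exp_le_exp.2 h2
  have h7 : Real.exp (D / 4) = Real.exp (D / 8) * Real.exp (D / 8) := by
    rw [← Real.exp_add]; congr 1; ring
  have h8 : (θ * d) ^ 2 * Real.exp |θ * d| ≤ 128 * θ ^ 2 * Real.exp (D / 4) := by
    rw [h7, mul_pow]
    calc θ ^ 2 * d ^ 2 * Real.exp |θ * d|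
        ≤ θ ^ 2 * (128 * Real.exp (D / 8)) * Real.exp (D / 8) := by gcongr
      _ = _ := by ring
  linarith

/-- An exponential moment of the logarithm of a squared standard Gaussian. -/
def logSqMoment : ℝ := ∫ t, Real.exp (|Real.log (t ^ 2)| / 4) ∂(gaussianReal 0 1)

theorem exp_abs_log_sq_le (t : ℝ) :
    Real.exp (|Real.log (t ^ 2)| / 4) ≤ 1 + |t| + |t| ^ (-(1 / 2) : ℝ) := by
  have h0 : 0 ≤ |t| ^ (-(1 / 2) : ℝ) := Real.rpow_nonneg (abs_nonneg t) _
  by_cases ht : t = 0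
  · subst ht; simp
  have hpos : 0 < |t| := abs_pos.2 ht
  have hlog : Real.log (t ^ 2) = 2 * Real.log |t| := by
    rw [Real.log_pow, Real.log_abs]; norm_num
  rw [hlog]
  rcases le_total 1 |t| with h | h
  · have hl := Real.log_nonneg h
    have h1 : Real.exp (|2 * Real.log (|t|)| / 4) ≤ |t| := by
      rw [abs_of_nonneg (by positivity)]
      calc Real.exp (2 * Real.log |t| / 4) ≤ Real.exp (Real.log |t|) :=
            Real.exp_le_exp.2 (by linarith)
        _ = |t| := Real.exp_log hpos
    linarith
  · have hl := Real.log_nonpos hpos.le h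
    have h1 : Real.exp (|2 * Real.log (|t|)| / 4) = |t| ^ (-(1 / 2) : ℝ) := by
      rw [abs_of_nonpos (by linarith), Real.rpow_def_of_pos hpos]
      congr 1; ring
    linarith [abs_nonneg t]

theorem integrable_exp_abs_log_sq :
    Integrable (fun t : ℝ => Real.exp (|Real.log (t ^ 2)| / 4)) (gaussianReal 0 1) := by
  have h1 : Integrable (fun t : ℝ => |t|) (gaussianReal 0 1) :=
    ((memLp_id_gaussianReal 1).integrable le_rfl).abs
  have h2 : Integrable (fun t : ℝ => |t| ^ (-(1 / 2) : ℝ)) (gaussianReal 0 1) := by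
    obtain ⟨C, -, hC⟩ := exists_lintegral_abs_add_rpow_le
    refine ⟨Measurable.aestronglyMeasurable (by fun_prop), ?_⟩
    rw [hasFiniteIntegral_iff_ofReal (ae_of_all _ fun t => Real.rpow_nonneg (abs_nonneg t) _)]
    simpa using (hC 0).trans_lt ENNReal.ofReal_lt_top
  refine Integrable.mono' (((integrable_const 1).add h1).add h2)
    (Measurable.aestronglyMeasurable (by fun_prop)) (ae_of_all _ fun t => ?_)
  rw [Real.norm_of_nonneg (Real.exp_nonneg _)]
  exact exp_abs_log_sq_le t

theorem abs_clip_log_sq_sub_le (N σ : ℝ) {s t : ℝ} (hs : s ≠ 0) (ht : t ≠ 0) :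
    |clip N (Real.log ((σ * s) ^ 2)) - clip N (Real.log ((σ * t) ^ 2))|
      ≤ |Real.log (s ^ 2)| + |Real.log (t ^ 2)| := by
  by_cases hσ : σ = 0
  · subst hσ; simp only [zero_mul, sub_self, abs_zero]; positivity
  refine (abs_clip_sub_clip_le _ _ _).trans ?_
  have h : ∀ u : ℝ, u ≠ 0 → Real.log ((σ * u) ^ 2) = Real.log (σ ^ 2) + Real.log (u ^ 2) :=
    fun u hu => by rw [mul_pow, Real.log_mul (pow_ne_zero 2 hσ) (pow_ne_zero 2 hu)]
  rw [h s hs, h t ht, add_sub_add_left_eq_sub]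
  exact abs_sub _ _

theorem integral_exp_clip_log_sq_le {N θ : ℝ} (hN : 0 ≤ N) (hθ : |θ| ≤ 1 / 8) (σ : ℝ) :
    ∫ p, Real.exp (θ * (clip N (Real.log ((σ * p.1) ^ 2)) -
      clip N (Real.log ((σ * p.2) ^ 2)))) ∂((gaussianReal 0 1).prod (gaussianReal 0 1))
      ≤ 1 + 128 * θ ^ 2 * logSqMoment ^ 2 := by
  set γ := gaussianReal 0 1 with hγ
  set φ : ℝ → ℝ := fun t => clip N (Real.log ((σ * t) ^ 2)) with hφ
  have hφm : Measurable φ := (measurable_clip N).comp (by fun_prop)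
  have hφb : ∀ t, |φ t| ≤ N := fun t => abs_clip_le hN _
  have hφi : Integrable φ γ :=
    Integrable.of_bound hφm.aestronglyMeasurable N (ae_of_all _ hφb)
  have hne : ∀ᵐ t ∂γ, t ≠ 0 := by
    have := nullSingletonClass_gaussianReal (μ := 0) (v := 1) one_ne_zero
    exact compl_mem_ae_iff.2 (measure_singleton _)
  have hdi : Integrable (fun p : ℝ × ℝ => θ * (φ p.1 - φ p.2)) (γ.prod γ) :=
    ((hφi.comp_fst γ).sub (hφi.comp_snd γ)).const_mul θ
  have hei : Integrable (fun p : ℝ × ℝ => Real.exp (|Real.log (p.1 ^ 2)| / 4) *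
      Real.exp (|Real.log (p.2 ^ 2)| / 4)) (γ.prod γ) :=
    integrable_exp_abs_log_sq.mul_prod integrable_exp_abs_log_sq
  have h1 : Integrable (fun p : ℝ × ℝ => 1 + θ * (φ p.1 - φ p.2)) (γ.prod γ) :=
    (integrable_const 1).add hdi
  have h2 := hei.const_mul (128 * θ ^ 2)
  calc ∫ p, Real.exp (θ * (φ p.1 - φ p.2)) ∂(γ.prod γ)
      ≤ ∫ p, (1 + θ * (φ p.1 - φ p.2) + 128 * θ ^ 2 *
          (Real.exp (|Real.log (p.1 ^ 2)| / 4) * Real.exp (|Real.log (p.2 ^ 2)| / 4)))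
          ∂(γ.prod γ) := by
        refine integral_mono_ae (integrable_exp_mul_of_bound (B := N + N)
          ((hφm.comp measurable_fst).sub (hφm.comp measurable_snd)) (fun p =>
            (abs_sub _ _).trans (add_le_add (hφb _) (hφb _))) θ) (h1.add h2) ?_
        filter_upwards [Measure.quasiMeasurePreserving_fst.ae hne,
          Measure.quasiMeasurePreserving_snd.ae hne] with p hp1 hp2
        have h3 := exp_mul_le_of_abs_le hθ (abs_clip_log_sq_sub_le N σ hp1 hp2)
        rwa [add_div, Real.exp_add] at h3
    _ = 1 + 128 * θ ^ 2 * logSqMoment ^ 2 := by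
        rw [integral_add h1 h2, integral_add (integrable_const 1) hdi, integral_const_mul,
          integral_const_mul, integral_sub (hφi.comp_fst γ) (hφi.comp_snd γ),
          integral_fun_fst, integral_fun_snd,
          integral_prod_mul (fun t => Real.exp (|Real.log (t ^ 2)| / 4))
            (fun t => Real.exp (|Real.log (t ^ 2)| / 4))]
        simp [logSqMoment, sq, hγ]

variable {ι : Type*} [Fintype ι]

theorem map_sum_gVec (c : ι → ℝ) (S : Finset ι) :
    (gVec ι).map (fun h => ∑ l ∈ S, c l * h l)
      = gaussianReal 0 (∑ l ∈ S, (c l ^ 2).toNNReal) := by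
  classical
  induction S using Finset.induction_on with
  | empty => simp [Measure.map_const]
  | insert k S hk ih =>
    have hind : iIndepFun (fun (l : ι) (h : ι → ℝ) => c l * h l) (gVec ι) :=
      iIndepFun_pi (X := fun l x => c l * x) fun l => by fun_prop
    have h1 := hind.indepFun_finsetSum_of_notMem (fun l => by fun_prop) hk
    have hS : (∑ l ∈ S, fun h : ι → ℝ => c l * h l) = fun h => ∑ l ∈ S, c l * h l := by
      funext h; simp
    have hk' : (gVec ι).map (fun h => c k * h k) = gaussianReal 0 (c k ^ 2).toNNReal := by
      have h2 := Measure.map_map (μ := gVec ι) (measurable_const_mul (c k))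
        (measurePreserving_eval (fun _ : ι => gaussianReal 0 1) k).measurable
      rw [(measurePreserving_eval _ k).map_eq, gaussianReal_map_const_mul] at h2
      refine h2.symm.trans ?_
      congr 1
      · simp
      · ext; simp [sq_nonneg]
    rw [hS] at h1
    have h3 := gaussianReal_add_gaussianReal_of_indepFun h1 ih hk'
    rw [Finset.sum_insert hk, add_comm (c k ^ 2).toNNReal]
    simp only [Finset.sum_insert hk]
    convert h3 using 2
    · funext h; simp [add_comm]
    · simp

theorem exists_map_sum_gVec_eq (c : ι → ℝ) : ∃ σ : ℝ,
    (gVec ι).map (fun h => ∑ l, c l * h l) = (gaussianReal 0 1).map (fun t => σ * t) := by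
  refine ⟨Real.sqrt (∑ l, c l ^ 2), ?_⟩
  rw [map_sum_gVec, gaussianReal_map_const_mul]
  congr 1
  · simp
  · ext
    simp [Real.sq_sqrt (Finset.sum_nonneg fun l _ => sq_nonneg (c l)), sq_nonneg]

theorem integral_exp_clip_linear_le {N θ : ℝ} (hN : 0 ≤ N) (hθ : |θ| ≤ 1 / 8) (c : ι → ℝ) :
    ∫ p, Real.exp (θ * (clip N (Real.log ((∑ l, c l * p.1 l) ^ 2)) -
      clip N (Real.log ((∑ l, c l * p.2 l) ^ 2)))) ∂((gVec ι).prod (gVec ι))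
      ≤ 1 + 128 * θ ^ 2 * logSqMoment ^ 2 := by
  obtain ⟨σ, hσ⟩ := exists_map_sum_gVec_eq c
  set G : ℝ × ℝ → ℝ := fun p =>
    Real.exp (θ * (clip N (Real.log (p.1 ^ 2)) - clip N (Real.log (p.2 ^ 2)))) with hG
  have hGm : Measurable G := by
    have h1 : Measurable fun x : ℝ => clip N (Real.log (x ^ 2)) :=
      (measurable_clip N).comp (by fun_prop)
    exact Real.measurable_exp.comp
      (((h1.comp measurable_fst).sub (h1.comp measurable_snd)).const_mul θ)
  have hL : Measurable fun h : ι → ℝ => ∑ l, c l * h l := by fun_prop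
  have hL' : Measurable fun t : ℝ => σ * t := by fun_prop
  have e1 : ((gVec ι).prod (gVec ι)).map (Prod.map (fun h => ∑ l, c l * h l)
      (fun h => ∑ l, c l * h l)) = ((gaussianReal 0 1).prod (gaussianReal 0 1)).map
      (Prod.map (fun t => σ * t) (fun t => σ * t)) := by
    rw [← Measure.map_prod_map _ _ hL hL, ← Measure.map_prod_map _ _ hL' hL', hσ]
  have h1 : ∫ p, G (Prod.map (fun h => ∑ l, c l * h l) (fun h => ∑ l, c l * h l) p)
      ∂((gVec ι).prod (gVec ι)) = ∫ p, G (Prod.map (fun t => σ * t) (fun t => σ * t) p)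
      ∂((gaussianReal 0 1).prod (gaussianReal 0 1)) := by
    rw [← integral_map (hL.prodMap hL).aemeasurable hGm.aestronglyMeasurable, e1,
      integral_map (hL'.prodMap hL').aemeasurable hGm.aestronglyMeasurable]
  exact h1.trans_le (integral_exp_clip_log_sq_le hN hθ σ)

variable [DecidableEq ι]

theorem det_profileMat_update (A : Matrix ι ι ℝ) (g : ι → ι → ℝ) (i : ι) (h : ι → ℝ) :
    (profileMat A (Function.update g i h)).det
      = ∑ l, (Real.sqrt (A i l) * (profileMat A g).adjugate l i) * h l := by
  rw [Matrix.det_eq_sum_mul_adjugate_row _ i]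
  refine Finset.sum_congr rfl fun l _ => ?_
  have h1 : (profileMat A (Function.update g i h)).adjugate l i
      = (profileMat A g).adjugate l i := by
    rw [Matrix.adjugate_apply, profileMat_update_updateRow, ← Matrix.adjugate_apply]
  rw [h1, profileMat_update_row]
  ring

theorem symmExpBound_clip_logDetSq (A : Matrix ι ι ℝ) {N θ : ℝ} (hN : 0 ≤ N)
    (hθ : |θ| ≤ 1 / 8) :
    SymmExpBound (gVec ι) θ (1 + 128 * θ ^ 2 * logSqMoment ^ 2)
      fun g => clip N (logDetSq A g) where
  measurable := (measurable_clip N).comp (measurable_logDetSq A)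
  bounded := ⟨N, fun g => abs_clip_le hN _⟩
  bound i g := by
    simp only [logDetSq, det_profileMat_update]
    exact integral_exp_clip_linear_le hN hθ _

end Slice

section Concentration

open Filter Topology

variable {ι : Type} [Fintype ι] [DecidableEq ι]

theorem tendsto_clip_natCast (x : ℝ) : Tendsto (fun N : ℕ => clip N x) atTop (𝓝 x) := by
  obtain ⟨m, hm⟩ := exists_nat_ge |x|
  refine tendsto_const_nhds.congr' ?_
  filter_upwards [eventually_ge_atTop m] with N hN
  exact (clip_of_abs_le (hm.trans (by exact_mod_cast hN))).symm

theorem lintegral_exp_logDetSq_sub_le {A : Matrix ι ι ℝ} (hint : Integrable (logDetSq A) (gMat ι))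
    {θ : ℝ} (hθ : |θ| ≤ 1 / 8) :
    ∫⁻ g, ENNReal.ofReal (Real.exp (θ * (logDetSq A g - ∫ h, logDetSq A h ∂(gMat ι)))) ∂(gMat ι)
      ≤ ENNReal.ofReal ((1 + 128 * θ ^ 2 * logSqMoment ^ 2) ^ Fintype.card ι) := by
  set f := logDetSq A
  have hf : Measurable f := measurable_logDetSq A
  have hM : 1 ≤ 1 + 128 * θ ^ 2 * logSqMoment ^ 2 := le_add_of_nonneg_right (by positivity)
  have hmean : Tendsto (fun N : ℕ => ∫ h, clip N (f h) ∂(gMat ι)) atTop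
      (𝓝 (∫ h, f h ∂(gMat ι))) :=
    tendsto_integral_of_dominated_convergence (fun g => |f g|)
      (fun N => ((measurable_clip N).comp hf).aestronglyMeasurable) hint.abs
      (fun N => ae_of_all _ fun g => abs_clip_le_abs N.cast_nonneg _)
      (ae_of_all _ fun g => tendsto_clip_natCast _)
  set F : ℕ → (ι → ι → ℝ) → ENNReal := fun N g =>
    ENNReal.ofReal (Real.exp (θ * (clip N (f g) - ∫ h, clip N (f h) ∂(gMat ι))))
  have hFm : ∀ N, Measurable (F N) := fun N =>
    (Real.measurable_exp.comp
      ((((measurable_clip N).comp hf).sub_const _).const_mul θ)).ennreal_ofReal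
  have hFle : ∀ N, ∫⁻ g, F N g ∂(gMat ι)
      ≤ ENNReal.ofReal ((1 + 128 * θ ^ 2 * logSqMoment ^ 2) ^ Fintype.card ι) := fun N => by
    have hs := symmExpBound_clip_logDetSq A (N.cast_nonneg (α := ℝ)) hθ
    rw [← ofReal_integral_eq_lintegral_ofReal ?_ (ae_of_all _ fun g => Real.exp_nonneg _)]
    · exact ENNReal.ofReal_le_ofReal (hs.integral_exp_le hM)
    · refine integrable_exp_mul_of_bound (((measurable_clip N).comp hf).sub_const _)
        (fun g => (abs_sub _ _).trans (add_le_add_left (abs_clip_le N.cast_nonneg _) _)) θ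
  calc _ = ∫⁻ g, liminf (fun N => F N g) atTop ∂(gMat ι) := by
        refine lintegral_congr fun g => (Tendsto.liminf_eq ?_).symm
        exact (ENNReal.continuous_ofReal.tendsto _).comp ((Real.continuous_exp.tendsto _).comp
          (((tendsto_clip_natCast _).sub hmean).const_mul θ))
    _ ≤ liminf (fun N => ∫⁻ g, F N g ∂(gMat ι)) atTop := lintegral_liminf_le hFm
    _ ≤ liminf (fun _ : ℕ => ENNReal.ofReal
          ((1 + 128 * θ ^ 2 * logSqMoment ^ 2) ^ Fintype.card ι)) atTop :=
        liminf_le_liminf (Eventually.of_forall hFle)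
    _ = _ := liminf_const _

theorem measure_le_mul_logDetSq_sub_le {A : Matrix ι ι ℝ}
    (hint : Integrable (logDetSq A) (gMat ι)) {θ : ℝ} (hθ : |θ| ≤ 1 / 8) (s : ℝ) :
    gMat ι {g | s ≤ θ * (logDetSq A g - ∫ h, logDetSq A h ∂(gMat ι))}
      ≤ ENNReal.ofReal
        (Real.exp (128 * (Fintype.card ι * θ ^ 2) * logSqMoment ^ 2 - s)) := by
  have h1 := (mul_meas_ge_le_lintegral₀ (μ := gMat ι) (f := fun g => ENNReal.ofReal
    (Real.exp (θ * (logDetSq A g - ∫ h, logDetSq A h ∂(gMat ι)))))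
    (Real.measurable_exp.comp
      (((measurable_logDetSq A).sub_const _).const_mul θ)).ennreal_ofReal.aemeasurable
    (ENNReal.ofReal (Real.exp s))).trans (lintegral_exp_logDetSq_sub_le hint hθ)
  have h2 : (1 + 128 * θ ^ 2 * logSqMoment ^ 2) ^ Fintype.card ι
      ≤ Real.exp (128 * (Fintype.card ι * θ ^ 2) * logSqMoment ^ 2) := by
    calc _ ≤ Real.exp (128 * θ ^ 2 * logSqMoment ^ 2) ^ Fintype.card ι := by
          gcongr
          linarith [Real.add_one_le_exp (128 * θ ^ 2 * logSqMoment ^ 2)]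
      _ = _ := by rw [← Real.exp_nat_mul]; congr 1; ring
  have h3 := h1.trans (ENNReal.ofReal_le_ofReal h2)
  simp only [ENNReal.ofReal_le_ofReal_iff (Real.exp_nonneg _), Real.exp_le_exp] at h3
  rw [Real.exp_sub, ENNReal.ofReal_div_of_pos (Real.exp_pos _),
    ENNReal.le_div_iff_mul_le (by simp [Real.exp_pos]) (by simp), mul_comm]
  exact h3

theorem measure_le_abs_logDetSq_sub_le {A : Matrix ι ι ℝ}
    (hint : Integrable (logDetSq A) (gMat ι)) (hn : 64 ≤ Fintype.card ι) (s : ℝ) :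
    gMat ι {g | s * √(Fintype.card ι) ≤ |logDetSq A g - ∫ h, logDetSq A h ∂(gMat ι)|}
      ≤ ENNReal.ofReal (2 * Real.exp (128 * logSqMoment ^ 2 - s)) := by
  have hn' : (64 : ℝ) ≤ Fintype.card ι := by exact_mod_cast hn
  set n := (Fintype.card ι : ℝ)
  have hr : 8 ≤ √n := Real.le_sqrt_of_sq_le (by linarith)
  have hr0 : 0 < √n := by linarith
  have hθ : |(√n)⁻¹| ≤ 1 / 8 := by
    rw [abs_of_pos (by positivity), ← one_div]
    gcongr
  have hsq : n * (√n)⁻¹ ^ 2 = 1 := by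
    rw [inv_pow, Real.sq_sqrt (by linarith), mul_inv_cancel₀ (by linarith)]
  have h1 := measure_le_mul_logDetSq_sub_le hint hθ s
  have h2 := measure_le_mul_logDetSq_sub_le hint (θ := -(√n)⁻¹) (by rwa [abs_neg]) s
  rw [neg_sq] at h2
  rw [hsq, mul_one] at h1 h2
  rw [two_mul, ENNReal.ofReal_add (Real.exp_nonneg _) (Real.exp_nonneg _)]
  refine (measure_mono fun g hg => ?_).trans ((measure_union_le _ _).trans (add_le_add h1 h2))
  rcases le_abs.1 (Set.mem_ofPred_eq ▸ hg) with h | h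
  · left
    rwa [Set.mem_ofPred_eq, inv_mul_eq_div, le_div_iff₀ hr0]
  · right
    rwa [Set.mem_ofPred_eq, neg_mul, ← mul_neg, inv_mul_eq_div, le_div_iff₀ hr0]

end Concentration

theorem log_factorial_le (n : ℕ) (hn : 1 ≤ n) :
    Real.log n.factorial ≤ n * Real.log n - n + Real.log n + 1 := by
  induction n, hn using Nat.le_induction with
  | base => simp
  | succ m hm ih =>
    have hm0 : (0 : ℝ) < m := by exact_mod_cast hm
    rw [Nat.factorial_succ, Nat.cast_mul, Real.log_mul (by positivity) (by positivity)]
    have h1 := Real.one_sub_inv_le_log_of_pos (show (0 : ℝ) < (m + 1) / m by positivity)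
    rw [Real.log_div (by positivity) hm0.ne', inv_div] at h1
    have h2 : 1 ≤ (m + 1) * (Real.log (m + 1) - Real.log m) := by
      calc (1 : ℝ) = (m + 1) * (1 - m / (m + 1)) := by field_simp; ring
        _ ≤ _ := by gcongr
    push_cast
    linarith

theorem le_log_factorial (n : ℕ) : n * Real.log n - n ≤ Real.log n.factorial := by
  rcases Nat.eq_zero_or_pos n with rfl | hn
  · simp
  have h1 := Stirling.le_log_factorial_stirling hn.ne'
  have h2 : 0 ≤ Real.log n := Real.log_natCast_nonneg n
  have h3 : 0 ≤ Real.log (2 * Real.pi) := Real.log_nonneg (by linarith [Real.pi_gt_three])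
  linarith

theorem abs_integral_logDetSq_sub_log_factorial_le {n : ℕ} (hn : 6 ≤ n) {lam K : ℝ}
    (hlam : 1 ≤ lam) (hlamn : lam ≤ n) {A : Matrix (Fin n) (Fin n) ℝ} (hA : ∀ i j, 0 < A i j)
    (hP : IsProfile A lam) (hK : 0 ≤ K)
    (hinv : ∀ i j, ∫⁻ g, ENNReal.ofReal (|(profileMat A g)⁻¹ i j| ^ (1 / 2 : ℝ)) ∂(gMat (Fin n))
      ≤ ENNReal.ofReal K) :
    |∫ g, logDetSq A g ∂(gMat (Fin n)) - Real.log n.factorial|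
      ≤ (86 + 4 * K) * (√(lam * n) * Real.log n) := by
  have hn' : (6 : ℝ) ≤ n := by exact_mod_cast hn
  have : Nonempty (Fin n) := ⟨⟨0, by omega⟩⟩
  have hint := integrable_logDetSq hA hK hinv
  have h1 := integral_logDetSq_le hA (by linarith) (by simpa using hlamn) hP hint
  have h2 := le_integral_logDetSq hA hlam hP hK hinv hint
  simp only [Fintype.card_fin] at h1 h2
  have h3 := log_factorial_le n (by omega)
  have h4 := le_log_factorial n
  have hL : 1 ≤ Real.log n := by
    rw [Real.le_log_iff_exp_le (by linarith)]
    linarith [Real.exp_one_lt_d9]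
  have hS : 1 ≤ √(lam * n) := Real.one_le_sqrt.2 (by nlinarith)
  have h5 : Real.log (6 * lam * n ^ 12) ≤ 14 * Real.log n := by
    rw [show (14 : ℝ) * Real.log n = Real.log (n ^ 14) by rw [Real.log_pow]; norm_num]
    refine Real.log_le_log (by positivity) ?_
    calc 6 * lam * n ^ 12 ≤ n * n * (n : ℝ) ^ 12 := by gcongr
      _ = _ := by ring
  have h6 : 6 * Real.log (6 * lam * n ^ 12) * √(lam * n)
      ≤ 84 * (√(lam * n) * Real.log n) := by nlinarith
  have h7 : Real.log n ≤ √(lam * n) * Real.log n := le_mul_of_one_le_left (by linarith) hS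
  have h8 : √(lam * n) ≤ √(lam * n) * Real.log n := le_mul_of_one_le_right (by linarith) hL
  have h9 : 4 * K ≤ 4 * K * (√(lam * n) * Real.log n) :=
    le_mul_of_one_le_right (by positivity) (by linarith)
  have h10 : 0 ≤ K * (√(lam * n) * Real.log n) := by positivity
  rw [abs_le]
  constructor <;> nlinarith

end GaussianDet

/-- concentration of `log det²` of a Gaussian matrix with doubly stochastic
variance profile around `log n!`. -/
theorem log_det_sq_concentration (ε : ℝ) (hε : 0 < ε) :
    ∃ c₀ c₁ c₂ : ℝ, 0 < c₀ ∧ 0 < c₁ ∧ 0 < c₂ ∧ ∃ n₀ : ℕ, ∀ n : ℕ, n₀ ≤ n →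
      ∀ lam : ℝ, 1 < lam → lam < n →
        ∀ A : Matrix (Fin n) (Fin n) ℝ,
          (∀ i j, ε ≤ A i j ∧ A i j ≤ lam) →
          (∀ i, ∑ j, A i j = n) → (∀ j, ∑ i, A i j = n) →
          (Measure.pi fun _ : Fin n × Fin n => gaussianReal 0 1)
              { g : Fin n × Fin n → ℝ |
                c₀ * Real.sqrt (lam * n) * (Real.log n) ^ c₁ ≤
                  |Real.log ((Matrix.of fun i j : Fin n =>
                      Real.sqrt (A i j) * g (i, j)).det ^ 2) - Real.log (Nat.factorial n)| }
            ≤ ENNReal.ofReal (Real.exp (-c₂ * (Real.log n) ^ 4)) := by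
  obtain ⟨C, hC, hinv⟩ := GaussianDet.exists_lintegral_inv_apply_le
  set K : ℝ := C * ε ^ (-(1 / 4) : ℝ)
  have hK : 0 ≤ K := by positivity
  set B : ℝ := 128 * GaussianDet.logSqMoment ^ 2
  have hB : 0 ≤ B := by positivity
  refine ⟨87 + 4 * K, 5, 1, by positivity, by norm_num, one_pos, max 64 ⌈Real.exp (B + 2)⌉₊,
    fun n hn lam hlam hlamn A hA hrow hcol => ?_⟩
  have hn64 : 64 ≤ n := (le_max_left _ _).trans hn
  have hnexp : Real.exp (B + 2) ≤ n := Nat.ceil_le.1 ((le_max_right _ _).trans hn)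
  set L := Real.log n
  have hL : B + 2 ≤ L := (Real.le_log_iff_exp_le (by positivity)).2 hnexp
  have hApos : ∀ i j, 0 < A i j := fun i j => hε.trans_le (hA i j).1
  have hP : GaussianDet.IsProfile A lam :=
    ⟨fun i j => (hApos i j).le, fun i j => (hA i j).2, by simpa using hrow, by simpa using hcol⟩
  have hinvA := hinv (Fin n) A ε hε fun i j => (hA i j).1
  have hint := GaussianDet.integrable_logDetSq hApos hK hinvA
  have hmean := GaussianDet.abs_integral_logDetSq_sub_log_factorial_le (by omega) hlam.le hlamn.le
    hApos hP hK hinvA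
  have hconc := GaussianDet.measure_le_abs_logDetSq_sub_le hint (by simpa using hn64) (L ^ 5)
  rw [Fintype.card_fin] at hconc
  rw [← (GaussianDet.measurePreserving_uncurry (ι := Fin n)).measure_preimage_equiv]
  refine (measure_mono fun g hg => ?_).trans (hconc.trans (ENNReal.ofReal_le_ofReal ?_))
  · replace hg : (87 + 4 * K) * √(lam * n) * L ^ (5 : ℝ)
        ≤ |GaussianDet.logDetSq A g - Real.log n.factorial| := hg
    rw [show L ^ (5 : ℝ) = L ^ 5 by norm_cast] at hg
    have hS : √(n : ℝ) ≤ √(lam * n) := Real.sqrt_le_sqrt (by nlinarith)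
    have hL5 : L ≤ L ^ 5 := le_self_pow₀ (by linarith) (by norm_num)
    have h1 : √(lam * n) * L ≤ √(lam * n) * L ^ 5 := by gcongr
    have h2 : L ^ 5 * √(n : ℝ) ≤ √(lam * n) * L ^ 5 := by
      rw [mul_comm]
      have : 0 ≤ L := by linarith
      gcongr
    have h3 := abs_sub_le (GaussianDet.logDetSq A g)
      (∫ h, GaussianDet.logDetSq A h ∂(GaussianDet.gMat (Fin n))) (Real.log n.factorial)
    rw [Set.mem_ofPred_eq]
    nlinarith
  · have h1 : 2 ≤ Real.exp 1 := by linarith [Real.exp_one_gt_d9]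
    have h2 : L ^ 5 = L ^ 4 * (L - 1) + L ^ 4 := by ring
    have h3 : L - 1 ≤ L ^ 4 * (L - 1) :=
      le_mul_of_one_le_left (by linarith) (one_le_pow₀ (by linarith))
    calc 2 * Real.exp (B - L ^ 5) ≤ Real.exp 1 * Real.exp (B - L ^ 5) := by gcongr
      _ = Real.exp (1 + (B - L ^ 5)) := (Real.exp_add _ _).symm
      _ ≤ Real.exp (-1 * L ^ 4) := Real.exp_le_exp.2 (by linarith)
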